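/- arXiv:2202.04923 — 2 statements merged into one kernel-verified Lean document; each statement's English description precedes it below -/
import Mathlib

section
/- For n = 12, the radical ideal I_{12} = ⋂_{P ∈ T_{12}} m_P ⊆ ℂ[x,y,z] of the set of triple points of the Böröczky arrangement B_{12} of 12 lines does NOT satisfy the containment I_{12}^{(3)} ⊆ I_{12}²; that is, there exists a polynomial in I_{12}^{(3)} = ⋂_{P ∈ T_{12}} m_P³ which does not belong to I_{12}². -/
open MvPolynomial

/-- The point on the unit circle at angle `α`. -/
noncomputable def Qpt (α : ℝ) : ℝ × ℝ := (Real.cos α, Real.sin α)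

/-- The `k`-th line of the Böröczky arrangement of `n` lines. -/
noncomputable def boLine (n k : ℕ) : Set (ℝ × ℝ) :=
  if Qpt (2 * k * Real.pi / n) = Qpt (Real.pi - 2 * (2 * k * Real.pi / n)) then
    {p : ℝ × ℝ | p.1 * Real.cos (2 * k * Real.pi / n)
        + p.2 * Real.sin (2 * k * Real.pi / n) = 1}
  else
    (affineSpan ℝ {Qpt (2 * k * Real.pi / n),
        Qpt (Real.pi - 2 * (2 * k * Real.pi / n))} : Set (ℝ × ℝ))

/-- The set of triple points of the Böröczky arrangement of `n` lines. -/
noncomputable def tripleSet (n : ℕ) : Set (ℝ × ℝ) :=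
  {p | 3 ≤ {k : ℕ | k < n ∧ p ∈ boLine n k}.ncard}

/-- The homogeneous ideal in `ℂ[x,y,z]` of the projective point `(a : b : 1)`
associated to the affine point `P = (a, b) ∈ ℝ²`. -/
noncomputable def mP (P : ℝ × ℝ) : Ideal (MvPolynomial (Fin 3) ℂ) :=
  Ideal.span {X 0 - C (P.1 : ℂ) * X 2, X 1 - C (P.2 : ℂ) * X 2}

/-! ### Characters of `SU(3)` as polynomials in the elementary symmetric functions -/

/-- The complete homogeneous symmetric polynomial of degree `n - 2` in three variables with
elementary symmetric functions `u`, `v` and `1`. -/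
def completeSymm {R : Type*} [CommRing R] (u v : R) : ℕ → R
  | 0 => 0
  | 1 => 0
  | 2 => 1
  | n + 3 => u * completeSymm u v (n + 2) - v * completeSymm u v (n + 1) + completeSymm u v n

/-- The irreducible character of `SU(3)` of highest weight `(a - 1, b - 1)` as a polynomial in the
fundamental characters `u` and `v`; it vanishes when `a = 0` or `b = 0`. -/
def shiftedChar {R : Type*} [CommRing R] (u v : R) (a b : ℕ) : R :=
  completeSymm u v (a + 1) * completeSymm v u (b + 1) - completeSymm u v a * completeSymm v u b

/-- The irreducible character of `SU(3)` of highest weight `l`. -/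
def irrChar {R : Type*} [CommRing R] (l : ℕ × ℕ) (u v : R) : R :=
  shiftedChar u v (l.1 + 1) (l.2 + 1)

theorem completeSymm_intCast {R : Type*} [CommRing R] (u v : ℤ) (n : ℕ) :
    completeSymm (u : R) (v : R) n = (completeSymm u v n : ℤ) := by
  induction n using completeSymm.induct with
  | case1 => simp [completeSymm]
  | case2 => simp [completeSymm]
  | case3 => simp [completeSymm]
  | case4 n h₁ h₂ h₃ => simp [completeSymm, h₁, h₂, h₃]

theorem irrChar_intCast {R : Type*} [CommRing R] (l : ℕ × ℕ) (u v : ℤ) :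
    irrChar l (u : R) (v : R) = (irrChar l u v : ℤ) := by
  simp [irrChar, shiftedChar, completeSymm_intCast]

section Pieri

variable {R : Type*} [CommRing R] (u v : R) (a b : ℕ)

theorem shiftedChar_zero_left : shiftedChar u v 0 b = 0 := by
  simp [shiftedChar, completeSymm]

theorem shiftedChar_zero_right : shiftedChar u v a 0 = 0 := by
  simp [shiftedChar, completeSymm]

theorem mul_shiftedChar_left : u * shiftedChar u v (a + 1) (b + 1) =
    shiftedChar u v (a + 2) (b + 1) + shiftedChar u v a (b + 2) + shiftedChar u v (a + 1) b := by
  simp only [shiftedChar, completeSymm]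
  ring

theorem mul_shiftedChar_right : v * shiftedChar u v (a + 1) (b + 1) =
    shiftedChar u v (a + 1) (b + 2) + shiftedChar u v (a + 2) b + shiftedChar u v a (b + 1) := by
  simp only [shiftedChar, completeSymm]
  ring

end Pieri

/-- The alternating sum of monomials with exponents `(a + b, b, 0)` in three variables. -/
def alternant {R : Type*} [CommRing R] (r s t : R) (a b : ℕ) : R :=
  r ^ (a + b) * s ^ b - r ^ (a + b) * t ^ b + s ^ (a + b) * t ^ b - s ^ (a + b) * r ^ b
    + t ^ (a + b) * r ^ b - t ^ (a + b) * s ^ b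

/-- The Weyl character formula for `SU(3)`. -/
theorem alternant_mul_shiftedChar {R : Type*} [CommRing R] {r s t : R} (h : r * s * t = 1)
    (a b : ℕ) :
    alternant r s t 1 1 * shiftedChar (r + s + t) (r * s + s * t + t * r) a b =
      alternant r s t a b := by
  have row_one (b : ℕ) :
      alternant r s t 1 1 * completeSymm (r * s + s * t + t * r) (r + s + t) (b + 1) =
        alternant r s t 1 b := by
    induction b using Nat.strong_induction_on with
    | _ b ih =>
      match b with
      | 0 => simp [alternant, completeSymm]
      | 1 => simp [completeSymm]
      | 2 =>
        simp only [alternant, completeSymm]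
        ring
      | b + 3 =>
        have h₀ := ih b (by omega)
        have h₁ := ih (b + 1) (by omega)
        have h₂ := ih (b + 2) (by omega)
        rw [show b + 3 + 1 = (b + 1) + 3 by ring, completeSymm]
        have h₃ : alternant r s t 1 (b + 3) = (r * s + s * t + t * r) * alternant r s t 1 (b + 2)
            - (r + s + t) * alternant r s t 1 (b + 1) + alternant r s t 1 b := by
          linear_combination (norm := (simp only [alternant]; ring))
            (-(r + s + t) * alternant r s t 1 (b + 1)
              + (r * s * t + 1) * alternant r s t 1 b) * h
        linear_combination (r * s + s * t + t * r) * h₂ - (r + s + t) * h₁ + h₀ - h₃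
  induction a using Nat.strong_induction_on generalizing b with
  | _ a ih =>
    match a, b with
    | 0, b =>
      rw [shiftedChar_zero_left, alternant, alternant]
      ring
    | 1, b =>
      simp [← row_one b, shiftedChar, completeSymm]
    | a + 2, 0 =>
      rw [shiftedChar_zero_right, alternant, alternant]
      ring
    | a + 2, b + 1 =>
      have h₀ := ih (a + 1) (by omega) (b + 1)
      have h₁ := ih a (by omega) (b + 2)
      have h₂ := ih (a + 1) (by omega) b
      have h₃ := mul_shiftedChar_left (r + s + t) (r * s + s * t + t * r) a b
      have h₄ : (r + s + t) * alternant r s t (a + 1) (b + 1) = alternant r s t (a + 2) (b + 1)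
          + alternant r s t a (b + 2) + alternant r s t (a + 1) b := by
        linear_combination (norm := (simp only [alternant]; ring)) alternant r s t (a + 1) b * h
      linear_combination (r + s + t) * h₀ - h₁ - h₂ - alternant r s t 1 1 * h₃ + h₄

/-! ### The certificate -/

/-- The weights of level at most `d`. -/
def weights (d : ℕ) : Finset (ℕ × ℕ) :=
  (Finset.range (d + 1) ×ˢ Finset.range (d + 1)).filter fun l => l.1 + l.2 ≤ d

/-- A representative of least level of the orbit of a weight `(a, b)` under the cyclic rotations of
the triple `(a, b, 9 - a - b)`. -/
def orbitRep (l : ℕ × ℕ) : ℕ × ℕ :=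
  let c := 9 - l.1 - l.2
  if l.1 < c ∧ l.2 ≤ c then l
  else if l.2 < l.1 ∧ c ≤ l.1 then (l.2, c)
  else if c < l.2 ∧ l.1 ≤ l.2 then (c, l.1)
  else l

/-- Points `(u, v)` with weights: the associated alternating sum of evaluations is a functional on
polynomials of degree at most `12` in `u`, `v`. -/
def certificate : List (ℤ × ℤ × ℤ) :=
  [(-31978678490850, 0, 2), (2389613898584640, 1, 2), (82488504545516160, 0, 1),
   (-1109710014340200, -1, 1), (22513484808360, -3, -1), (-6533787924456090480, -1, 0),
   (112556361826545, -2, 2), (227836134757598640, -2, 1), (-463925641524800, -1, 2),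
   (3186257206593825, -2, 0), (14443042199040, 0, 3), (-1239900715838400, -2, -1),
   (-7083360082310928, -3, 2), (-303661614165, -4, 0), (-1082953441908, -3, 1),
   (168350786676240, -4, 3)]

/-- The alternating sum of the values of `h` at the points of the certificate. -/
def certSum {R : Type*} [CommRing R] (h : R → R → R) : R :=
  (certificate.map fun e => (e.1 : R) * (h e.2.1 e.2.2 - h e.2.2 e.2.1)).sum

/-- The difference between a character and the character of the orbit representative. -/
def orbitDiff {R : Type*} [CommRing R] (l : ℕ × ℕ) (u v : R) : R :=
  irrChar l u v - irrChar (orbitRep l) u v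

theorem orbitRep_eq_self : ∀ l ∈ weights 4, orbitRep l = l := by
  decide +kernel

theorem certSum_orbitDiff_mul_int : ∀ d ∈ Finset.Icc 5 7, ∀ l ∈ weights d, orbitRep l = l ∨
    ∀ m ∈ weights (12 - d), orbitRep m = m ∨
      (certSum fun u v : ℤ => orbitDiff l u v * orbitDiff m u v) = 0 := by
  decide +kernel

theorem mem_weights {d : ℕ} {l : ℕ × ℕ} : l ∈ weights d ↔ l.1 + l.2 ≤ d := by
  simp only [weights, Finset.mem_filter, Finset.mem_product, Finset.mem_range]
  omega

theorem certSum_intCast {R : Type*} [CommRing R] (h : ℤ → ℤ → ℤ) (g : R → R → R)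
    (hg : ∀ u v : ℤ, g u v = h u v) : certSum g = (certSum h : ℤ) := by
  simp [certSum, certificate, ← hg]

theorem certSum_sum {R ι : Type*} [CommRing R] (s : Finset ι) (h : ι → R → R → R) :
    (certSum fun u v => ∑ i ∈ s, h i u v) = ∑ i ∈ s, certSum (h i) := by
  simp only [certSum, certificate, List.map_cons, List.map_nil, List.sum_cons, List.sum_nil,
    ← Finset.sum_sub_distrib, Finset.mul_sum, ← Finset.sum_add_distrib, add_zero]

theorem certSum_const_mul {R : Type*} [CommRing R] (c : R) (h : R → R → R) :
    (certSum fun u v => c * h u v) = c * certSum h := by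
  simp only [certSum, ← List.sum_map_mul_left]
  congr 2
  ext
  ring

theorem certSum_orbitDiff_mul {R : Type*} [CommRing R] {d : ℕ} (hd : d ∈ Finset.Icc 5 7)
    {l m : ℕ × ℕ} (hl : l ∈ weights d) (hm : m ∈ weights (12 - d)) :
    (certSum fun u v : R => orbitDiff l u v * orbitDiff m u v) = 0 := by
  have self {l : ℕ × ℕ} (h : orbitRep l = l) (u v : R) : orbitDiff l u v = 0 := by
    simp [orbitDiff, h]
  rcases certSum_orbitDiff_mul_int d hd l hl with h | h
  · simp [self h, certSum]
  rcases h m hm with h | h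
  · simp [self h, certSum]
  rw [certSum_intCast _ _ fun u v => ?_, h, Int.cast_zero]
  simp [orbitDiff, irrChar_intCast]

/-! ### Homogeneous components in the coordinates `u = x + iy`, `v = x - iy` -/

/-- The restriction of a polynomial to the line through the origin and the point with `z = 1`,
`x + iy = u` and `x - iy = v`. -/
noncomputable def restrictLine (u v : ℂ) : MvPolynomial (Fin 3) ℂ →ₐ[ℂ] Polynomial ℂ :=
  aeval ![Polynomial.C ((u + v) / 2) * Polynomial.X,
    Polynomial.C ((u - v) / (2 * Complex.I)) * Polynomial.X, Polynomial.X]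

theorem restrictLine_X_zero (u v : ℂ) :
    restrictLine u v (X 0) = Polynomial.C ((u + v) / 2) * Polynomial.X := by
  simp [restrictLine]

theorem restrictLine_X_one (u v : ℂ) :
    restrictLine u v (X 1) = Polynomial.C ((u - v) / (2 * Complex.I)) * Polynomial.X := by
  simp [restrictLine]

theorem restrictLine_X_two (u v : ℂ) : restrictLine u v (X 2) = Polynomial.X := by
  simp [restrictLine]

theorem restrictLine_C (u v c : ℂ) : restrictLine u v (C c) = Polynomial.C c := by
  simp [restrictLine]

/-- The span of the characters of level at most `d`, as functions on the plane. -/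
noncomputable def charSpan (d : ℕ) : Submodule ℂ (ℂ × ℂ → ℂ) :=
  Submodule.span ℂ ((fun l (p : ℂ × ℂ) => irrChar l p.1 p.2) '' (weights d : Set (ℕ × ℕ)))

theorem shiftedChar_mem_charSpan {a b d : ℕ} (h : a + b ≤ d + 2) :
    (fun p : ℂ × ℂ => shiftedChar p.1 p.2 a b) ∈ charSpan d := by
  match a, b with
  | 0, b =>
    simp only [shiftedChar_zero_left]
    exact Submodule.zero_mem _
  | a, 0 =>
    simp only [shiftedChar_zero_right]
    exact Submodule.zero_mem _
  | a + 1, b + 1 =>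
    refine Submodule.subset_span ⟨(a, b), ?_, rfl⟩
    simp only [Finset.mem_coe, mem_weights]
    omega

theorem fst_mul_mem_charSpan {d : ℕ} {f : ℂ × ℂ → ℂ} (hf : f ∈ charSpan d) :
    (fun p => p.1 * f p) ∈ charSpan (d + 1) := by
  induction hf using Submodule.span_induction with
  | mem f hf =>
    obtain ⟨⟨a, b⟩, hl, rfl⟩ := hf
    simp only [Finset.mem_coe, mem_weights] at hl
    simp only [irrChar, mul_shiftedChar_left]
    exact ((charSpan _).add_mem ((charSpan _).add_mem (shiftedChar_mem_charSpan (by omega))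
      (shiftedChar_mem_charSpan (by omega))) (shiftedChar_mem_charSpan (by omega)))
  | zero =>
    convert (charSpan (d + 1)).zero_mem using 2
    simp
  | add f g _ _ hf hg =>
    convert (charSpan (d + 1)).add_mem hf hg using 2
    simp [mul_add]
  | smul c f _ hf =>
    convert (charSpan (d + 1)).smul_mem c hf using 2
    simp [mul_left_comm]

theorem snd_mul_mem_charSpan {d : ℕ} {f : ℂ × ℂ → ℂ} (hf : f ∈ charSpan d) :
    (fun p => p.2 * f p) ∈ charSpan (d + 1) := by
  induction hf using Submodule.span_induction with
  | mem f hf =>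
    obtain ⟨⟨a, b⟩, hl, rfl⟩ := hf
    simp only [Finset.mem_coe, mem_weights] at hl
    simp only [irrChar, mul_shiftedChar_right]
    exact ((charSpan _).add_mem ((charSpan _).add_mem (shiftedChar_mem_charSpan (by omega))
      (shiftedChar_mem_charSpan (by omega))) (shiftedChar_mem_charSpan (by omega)))
  | zero =>
    convert (charSpan (d + 1)).zero_mem using 2
    simp
  | add f g _ _ hf hg =>
    convert (charSpan (d + 1)).add_mem hf hg using 2
    simp [mul_add]
  | smul c f _ hf =>
    convert (charSpan (d + 1)).smul_mem c hf using 2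
    simp [mul_left_comm]

theorem charSpan_le_succ (d : ℕ) : charSpan d ≤ charSpan (d + 1) :=
  Submodule.span_mono (Set.image_mono fun l hl => by
    simp only [Finset.mem_coe, mem_weights] at hl ⊢
    omega)

theorem coeff_restrictLine_mem_charSpan (f : MvPolynomial (Fin 3) ℂ) (d : ℕ) :
    (fun p : ℂ × ℂ => (restrictLine p.1 p.2 f).coeff d) ∈ charSpan d := by
  induction f using MvPolynomial.induction_on generalizing d with
  | C c =>
    match d with
    | 0 =>
      have h := (charSpan 0).smul_mem c (shiftedChar_mem_charSpan (a := 1) (b := 1) (by simp))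
      convert h using 2 with p
      simp [restrictLine, shiftedChar, completeSymm]
    | d + 1 =>
      convert (charSpan (d + 1)).zero_mem using 2 with p
      simp [restrictLine]
  | add f g hf hg =>
    convert (charSpan d).add_mem (hf d) (hg d) using 2
    simp
  | mul_X f i hf =>
    match d with
    | 0 =>
      convert (charSpan 0).zero_mem using 2 with p
      fin_cases i <;> simp [restrictLine, Polynomial.mul_coeff_zero]
    | d + 1 =>
      have hu := fst_mul_mem_charSpan (hf d)
      have hv := snd_mul_mem_charSpan (hf d)
      fin_cases i
      · convert (charSpan (d + 1)).smul_mem (1 / 2) ((charSpan _).add_mem hu hv) using 2 with p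
        simp only [Fin.zero_eta, map_mul, restrictLine_X_zero, ← mul_assoc, Polynomial.coeff_mul_X,
          Polynomial.coeff_mul_C, Pi.smul_apply, Pi.add_apply, smul_eq_mul]
        ring
      · convert (charSpan (d + 1)).smul_mem (1 / (2 * Complex.I)) ((charSpan _).sub_mem hu hv)
          using 2 with p
        simp only [Fin.mk_one, map_mul, restrictLine_X_one, ← mul_assoc, Polynomial.coeff_mul_X,
          Polynomial.coeff_mul_C, Pi.smul_apply, Pi.sub_apply, smul_eq_mul]
        ring
      · convert charSpan_le_succ d (hf d) using 2 with p
        simp only [Fin.reduceFinMk, map_mul, restrictLine_X_two, Polynomial.coeff_mul_X]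

/-! ### The lines and triple points of the arrangement -/

theorem mem_affineSpan_pair_iff_of_ne {A B P : ℝ × ℝ} (h : A ≠ B) :
    P ∈ affineSpan ℝ {A, B} ↔
      (P.1 - A.1) * (B.2 - A.2) = (P.2 - A.2) * (B.1 - A.1) := by
  rw [mem_affineSpan_pair_iff_exists_lineMap_eq]
  constructor
  · rintro ⟨s, rfl⟩
    simp [AffineMap.lineMap_apply]
    ring
  · intro e
    have hpos : (B.1 - A.1) ^ 2 + (B.2 - A.2) ^ 2 ≠ 0 := by
      contrapose! h
      ext <;> nlinarith [sq_nonneg (B.1 - A.1), sq_nonneg (B.2 - A.2)]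
    refine ⟨((P.1 - A.1) * (B.1 - A.1) + (P.2 - A.2) * (B.2 - A.2)) /
      ((B.1 - A.1) ^ 2 + (B.2 - A.2) ^ 2), ?_⟩
    ext
    · simp only [AffineMap.lineMap_apply, vsub_eq_sub, vadd_eq_add, Prod.fst_add, Prod.smul_fst,
        Prod.fst_sub, smul_eq_mul]
      field_simp
      linear_combination -(B.2 - A.2) * e
    · simp only [AffineMap.lineMap_apply, vsub_eq_sub, vadd_eq_add, Prod.snd_add, Prod.smul_snd,
        Prod.snd_sub, smul_eq_mul]
      field_simp
      linear_combination (B.1 - A.1) * e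

/-- The lines of the arrangement in terms of the complex coordinate `w = x + iy`: with
`t = exp (i α)`, the line is given by `t² w - t w̄ = t³ - 1`. -/
theorem mem_boLine_iff (n k : ℕ) (P : ℝ × ℝ) (t : ℂ)
    (ht : t = Complex.exp ((2 * k * Real.pi / n : ℝ) * Complex.I)) :
    P ∈ boLine n k ↔
      t ^ 2 * (P.1 + P.2 * Complex.I) - t * (P.1 - P.2 * Complex.I) = t ^ 3 - 1 := by
  obtain ⟨x, y⟩ := P
  unfold boLine
  generalize 2 * (k : ℝ) * Real.pi / n = α at *
  have ht₀ : t ≠ 0 := ht ▸ Complex.exp_ne_zero _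
  rw [Complex.exp_mul_I, ← Complex.ofReal_cos, ← Complex.ofReal_sin] at ht
  simp only [Qpt, Real.cos_pi_sub, Real.sin_pi_sub, Real.cos_two_mul, Real.sin_two_mul]
  have hcs := Real.sin_sq_add_cos_sq α
  generalize Real.cos α = c at *
  generalize Real.sin α = s at *
  have hcs' : (s : ℂ) ^ 2 + (c : ℂ) ^ 2 = 1 := mod_cast hcs
  have hI : Complex.I ^ 2 = -1 := Complex.I_sq
  have htt : (c + s * Complex.I) * (c - s * Complex.I) = 1 := by
    linear_combination hcs' - (s : ℂ) ^ 2 * hI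
  have cube : t ^ 3 + 1 = 0 ↔ c = -(2 * c ^ 2 - 1) ∧ s = 2 * s * c := by
    have e : (t ^ 3 + 1) * (c - s * Complex.I) ^ 2 =
        ((c + (2 * c ^ 2 - 1) : ℝ) : ℂ) + ((s - 2 * s * c : ℝ) : ℂ) * Complex.I := by
      push_cast
      rw [ht]
      linear_combination (c + s * Complex.I) *
        ((c + s * Complex.I) * (c - s * Complex.I) + 1) * htt + (s : ℂ) ^ 2 * hI - hcs'
    have hne : (c - s * Complex.I : ℂ) ^ 2 ≠ 0 := by
      refine pow_ne_zero _ fun h => one_ne_zero (α := ℂ) ?_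
      linear_combination (c + s * Complex.I) * h - hcs' + (s : ℂ) ^ 2 * hI
    rw [← mul_eq_zero_iff_right hne, e, Complex.ext_iff]
    simp only [Complex.add_re, Complex.ofReal_re, Complex.re_ofReal_mul, Complex.I_re, mul_zero,
      add_zero, Complex.zero_re, Complex.add_im, Complex.ofReal_im, Complex.im_ofReal_mul,
      Complex.I_im, mul_one, zero_add, Complex.zero_im]
    constructor <;> rintro ⟨h₁, h₂⟩ <;> constructor <;> linarith
  split_ifs with h
  · rw [Prod.mk.injEq, ← cube] at h
    have e : t ^ 2 * (x + y * Complex.I) - t * (x - y * Complex.I) - (t ^ 3 - 1) =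
        2 * t ^ 3 * ((x * c + y * s - 1 : ℝ) : ℂ) := by
      push_cast
      rw [ht] at h ⊢
      linear_combination (-x * (c + s * Complex.I) + y * Complex.I * (c + s * Complex.I) + 1) * h
        + (-x - y * Complex.I) * (c + s * Complex.I) ^ 2 * htt
        - 2 * (c + s * Complex.I) ^ 3 * y * s * hI
    rw [Set.mem_ofPred_eq, ← sub_eq_zero, ← sub_eq_zero (a := t ^ 2 * _ - _), e,
      mul_eq_zero_iff_left (by simp [ht₀]), Complex.ofReal_eq_zero]
  · rw [SetLike.mem_coe, mem_affineSpan_pair_iff_of_ne h]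
    rw [Prod.mk.injEq, ← cube] at h
    have e : (t ^ 3 + 1) *
        (t ^ 2 * (x + y * Complex.I) - t * (x - y * Complex.I) - (t ^ 3 - 1)) =
        2 * Complex.I * t ^ 3 * (((x - c) * (2 * s * c - s) -
          (y - s) * (-(2 * c ^ 2 - 1) - c) : ℝ) : ℂ) := by
      push_cast
      rw [ht]
      linear_combination (x * (-(c + s * Complex.I) ^ 2 + (c + s * Complex.I) *
        ((c + s * Complex.I) * (c - s * Complex.I) + 1)) + y * Complex.I *
        (-2 * (c + s * Complex.I) ^ 3 - (c + s * Complex.I) *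
        ((c + s * Complex.I) * (c - s * Complex.I) + 1) - (c + s * Complex.I) ^ 2)
        + (c + s * Complex.I) ^ 4 - (c + s * Complex.I) ^ 3 * (c - s * Complex.I)
        - (1 + (c + s * Complex.I) * (c - s * Complex.I)
          + ((c + s * Complex.I) * (c - s * Complex.I)) ^ 2)) * htt
    rw [← sub_eq_zero, ← sub_eq_zero (a := t ^ 2 * _ - _), ← mul_eq_zero_iff_left h, e,
      mul_eq_zero_iff_left (by simp [ht₀]), Complex.ofReal_eq_zero]

/-- A primitive twelfth root of unity. -/
noncomputable def zeta : ℂ := Complex.exp (2 * Real.pi * Complex.I / 12)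

theorem isPrimitiveRoot_zeta : IsPrimitiveRoot zeta 12 := by
  simpa [zeta] using Complex.isPrimitiveRoot_exp 12 (by norm_num)

theorem mem_boLine_twelve_iff (k : ℕ) (P : ℝ × ℝ) :
    P ∈ boLine 12 k ↔ (zeta ^ k) ^ 2 * (P.1 + P.2 * Complex.I)
      - zeta ^ k * (P.1 - P.2 * Complex.I) = (zeta ^ k) ^ 3 - 1 := by
  refine mem_boLine_iff 12 k P _ ?_
  rw [zeta, ← Complex.exp_nat_mul]
  congr 1
  push_cast
  ring

theorem exists_mem_tripleSet {i j k : ℕ} (hi : i < 12) (hj : j < 12) (hk : k < 12)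
    (hij : i ≠ j) (hik : i ≠ k) (hjk : j ≠ k) (h : zeta ^ i * zeta ^ j * zeta ^ k = 1) :
    ∃ P ∈ tripleSet 12, P.1 + P.2 * Complex.I = zeta ^ i + zeta ^ j + zeta ^ k ∧
      P.1 - P.2 * Complex.I = zeta ^ i * zeta ^ j + zeta ^ j * zeta ^ k + zeta ^ k * zeta ^ i := by
  have conj_pow (n : ℕ) : (starRingEnd ℂ) (zeta ^ n) = (zeta ^ n)⁻¹ :=
    (Complex.inv_eq_conj (by
      rw [norm_pow, isPrimitiveRoot_zeta.norm'_eq_one (by norm_num), one_pow])).symm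
  have ne_zero (n : ℕ) : zeta ^ n ≠ 0 := pow_ne_zero _ (Complex.exp_ne_zero _)
  set w := zeta ^ i + zeta ^ j + zeta ^ k with hw
  have h₁ : (w.re + w.im * Complex.I : ℂ) = w := Complex.re_add_im w
  have h₂ : (w.re - w.im * Complex.I : ℂ) =
      zeta ^ i * zeta ^ j + zeta ^ j * zeta ^ k + zeta ^ k * zeta ^ i := by
    have e : (w.re - w.im * Complex.I : ℂ) = (starRingEnd ℂ) w := by
      apply Complex.ext <;> simp
    rw [e, hw, map_add, map_add, conj_pow, conj_pow, conj_pow]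
    have hi := ne_zero i
    have hj := ne_zero j
    have hk := ne_zero k
    field_simp
    linear_combination (-(zeta ^ i * zeta ^ j + zeta ^ j * zeta ^ k + zeta ^ k * zeta ^ i)) * h
  refine ⟨(w.re, w.im), ?_, h₁, h₂⟩
  have hsub : (({i, j, k} : Finset ℕ) : Set ℕ) ⊆ {l | l < 12 ∧ (w.re, w.im) ∈ boLine 12 l} := by
    intro l hl
    simp only [Finset.coe_insert, Finset.coe_singleton, Set.mem_insert_iff,
      Set.mem_singleton_iff] at hl
    rw [Set.mem_ofPred_eq, mem_boLine_twelve_iff, h₁, h₂, hw]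
    rcases hl with rfl | rfl | rfl
    · exact ⟨hi, by linear_combination -h⟩
    · exact ⟨hj, by linear_combination -h⟩
    · exact ⟨hk, by linear_combination -h⟩
  have hcard := Set.ncard_le_ncard hsub ((Set.finite_lt_nat 12).subset fun l hl => hl.1)
  rwa [Set.ncard_coe_finset, Finset.card_eq_three.2 ⟨i, j, k, hij, hik, hjk, rfl⟩] at hcard

theorem restrictLine_eq_zero {f : MvPolynomial (Fin 3) ℂ} {P : ℝ × ℝ} (hf : f ∈ mP P) :
    restrictLine (P.1 + P.2 * Complex.I) (P.1 - P.2 * Complex.I) f = 0 := by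
  have hle : mP P ≤ RingHom.ker
      (restrictLine (P.1 + P.2 * Complex.I) (P.1 - P.2 * Complex.I)) := by
    rw [mP, Ideal.span_le]
    rintro _ (rfl | rfl)
    · rw [SetLike.mem_coe, RingHom.mem_ker, map_sub, map_mul, restrictLine_X_zero,
        restrictLine_X_two, restrictLine_C]
      ring_nf
    · rw [SetLike.mem_coe, RingHom.mem_ker, map_sub, map_mul, restrictLine_X_one,
        restrictLine_X_two, restrictLine_C, ← sub_mul]
      convert zero_mul _
      rw [← Polynomial.C_sub, Polynomial.C_eq_zero]
      field_simp
      ring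
  exact hle hf

/-- The ideal of the triple points. -/
noncomputable def tripleIdeal : Ideal (MvPolynomial (Fin 3) ℂ) := ⨅ P ∈ tripleSet 12, mP P

theorem alternant_mul_coeff_eq_zero {f : MvPolynomial (Fin 3) ℂ} (hf : f ∈ tripleIdeal)
    {r s t : ℂ} (hr : r ^ 12 = 1) (hs : s ^ 12 = 1) (ht : t ^ 12 = 1) (h : r * s * t = 1) (d : ℕ) :
    alternant r s t 1 1 * (restrictLine (r + s + t) (r * s + s * t + t * r) f).coeff d = 0 := by
  by_cases hrs : r = s
  · simp only [alternant, hrs]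
    ring
  by_cases hst : s = t
  · simp only [alternant, hst]
    ring
  by_cases hrt : r = t
  · simp only [alternant, hrt]
    ring
  obtain ⟨i, hi, rfl⟩ := isPrimitiveRoot_zeta.eq_pow_of_pow_eq_one hr
  obtain ⟨j, hj, rfl⟩ := isPrimitiveRoot_zeta.eq_pow_of_pow_eq_one hs
  obtain ⟨k, hk, rfl⟩ := isPrimitiveRoot_zeta.eq_pow_of_pow_eq_one ht
  obtain ⟨P, hP, h₁, h₂⟩ := exists_mem_tripleSet hi hj hk (fun e => hrs (by rw [e]))
    (fun e => hrt (by rw [e])) (fun e => hst (by rw [e])) h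
  rw [← h₁, ← h₂, restrictLine_eq_zero, Polynomial.coeff_zero, mul_zero]
  simp only [tripleIdeal, Submodule.mem_iInf] at hf
  exact hf P hP

/-! ### Fourier analysis on the torus of twelfth roots of unity -/

theorem sum_zeta_pow_mul (n : ℕ) :
    ∑ i ∈ Finset.range 12, zeta ^ (n * i) = if 12 ∣ n then 12 else 0 := by
  simp only [pow_mul]
  split_ifs with h
  · simp [(isPrimitiveRoot_zeta.pow_eq_one_iff_dvd n).2 h]
  · have h₁ : zeta ^ n - 1 ≠ 0 :=
      sub_ne_zero.2 fun e => h ((isPrimitiveRoot_zeta.pow_eq_one_iff_dvd n).1 e)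
    refine (mul_eq_zero_iff_left h₁).1 ?_
    rw [mul_geom_sum, ← pow_mul, mul_comm, pow_mul, isPrimitiveRoot_zeta.pow_eq_one, one_pow,
      sub_self]

/-- The average of `ζ ^ (p i + q j) r ^ x s ^ y t ^ z` over the points `r = ζ ^ i`, `s = ζ ^ j`,
`t = (r s)⁻¹`. -/
def torusAverage (p q x y z : ℕ) : ℤ :=
  if 12 ∣ p + x + 11 * z ∧ 12 ∣ q + y + 11 * z then 1 else 0

theorem sum_torus (p q x y z : ℕ) :
    ∑ i ∈ Finset.range 12, ∑ j ∈ Finset.range 12, zeta ^ (p * i + q * j) *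
      ((zeta ^ i) ^ x * (zeta ^ j) ^ y * (zeta ^ (11 * (i + j))) ^ z) =
      144 * torusAverage p q x y z := by
  calc
    _ = ∑ i ∈ Finset.range 12, ∑ j ∈ Finset.range 12,
        zeta ^ ((p + x + 11 * z) * i) * zeta ^ ((q + y + 11 * z) * j) := by
      refine Finset.sum_congr rfl fun i _ => Finset.sum_congr rfl fun j _ => ?_
      simp only [← pow_mul, ← pow_add]
      ring_nf
    _ = _ := by
      simp only [← Finset.mul_sum, ← Finset.sum_mul, sum_zeta_pow_mul, torusAverage]
      split_ifs <;> simp_all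
      norm_num

/-- The Fourier coefficient, at the leading exponent of the numerator of the character of highest
weight `m`, of the numerator of the character of highest weight `l`. -/
def charFourierCoeff (l m : ℕ × ℕ) : ℤ :=
  let avg := torusAverage (24 - (m.1 + 1 + (m.2 + 1))) (24 - (m.2 + 1))
  let a := l.1 + 1 + (l.2 + 1)
  let b := l.2 + 1
  avg a b 0 - avg a 0 b + avg 0 a b - avg b a 0 + avg b 0 a - avg 0 b a

theorem sum_alternant (l m : ℕ × ℕ) :
    ∑ i ∈ Finset.range 12, ∑ j ∈ Finset.range 12,
      zeta ^ ((24 - (m.1 + 1 + (m.2 + 1))) * i + (24 - (m.2 + 1)) * j) *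
        alternant (zeta ^ i) (zeta ^ j) (zeta ^ (11 * (i + j))) (l.1 + 1) (l.2 + 1) =
      144 * charFourierCoeff l m := by
  simp only [charFourierCoeff, Int.cast_add, Int.cast_sub, mul_add, mul_sub, ← sum_torus,
    ← Finset.sum_add_distrib, ← Finset.sum_sub_distrib, alternant, pow_zero, mul_one, one_mul]
  refine Finset.sum_congr rfl fun i _ => Finset.sum_congr rfl fun j _ => ?_
  ring

theorem orbitRep_indicator : ∀ l ∈ weights 7, ∀ m ∈ weights 7,
    (if orbitRep l = m then 3 else 0 : ℤ) =
      (if orbitRep m = m then if m = (3, 3) then 1 else 3 else 0) * charFourierCoeff l m := by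
  decide +kernel

theorem orbitRep_mem_weights : ∀ l ∈ weights 7, orbitRep l ∈ weights 7 := by
  decide +kernel

theorem weights_mono {d e : ℕ} (h : d ≤ e) : weights d ⊆ weights e := fun l hl => by
  rw [mem_weights] at hl ⊢
  omega

/-- A component of degree at most `7` of a polynomial vanishing at the triple points is a
combination of differences of characters in the same orbit. -/
theorem exists_coeff_eq_sum_orbitDiff {f : MvPolynomial (Fin 3) ℂ} (hf : f ∈ tripleIdeal) {d : ℕ}
    (hd : d ≤ 7) : ∃ c : ℕ × ℕ → ℂ, ∀ u v : ℂ,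
      (restrictLine u v f).coeff d = ∑ l ∈ weights d, c l * orbitDiff l u v := by
  obtain ⟨c, hc⟩ := (Submodule.mem_span_image_finset_iff_exists_fun' ℂ).1
    (coeff_restrictLine_mem_charSpan f d)
  have hc' (u v : ℂ) : (restrictLine u v f).coeff d = ∑ l ∈ weights d, c l * irrChar l u v := by
    simpa using (congrFun hc (u, v)).symm
  refine ⟨c, fun u v => ?_⟩
  have key (m : ℕ × ℕ) : ∑ l ∈ weights d, c l * (charFourierCoeff l m : ℂ) = 0 := by
    have h144 : (144 : ℂ) ≠ 0 := by norm_num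
    refine (mul_eq_zero_iff_left h144).1 ?_
    simp only [Finset.mul_sum, mul_left_comm _ (c _), ← sum_alternant]
    rw [Finset.sum_comm]
    refine Finset.sum_eq_zero fun i _ => ?_
    rw [Finset.sum_comm]
    refine Finset.sum_eq_zero fun j _ => ?_
    have root (n : ℕ) : (zeta ^ n) ^ 12 = 1 := by
      rw [← pow_mul, mul_comm, pow_mul, isPrimitiveRoot_zeta.pow_eq_one, one_pow]
    have hprod : zeta ^ i * zeta ^ j * zeta ^ (11 * (i + j)) = 1 := by
      rw [← root (i + j)]
      ring
    have h₀ := alternant_mul_coeff_eq_zero hf (root i) (root j) (root _) hprod d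
    rw [hc', Finset.mul_sum] at h₀
    simp only [mul_left_comm _ (c _), irrChar, alternant_mul_shiftedChar hprod] at h₀ ⊢
    rw [Finset.sum_congr rfl fun l _ => mul_left_comm (c l) _ _, ← Finset.mul_sum, h₀, mul_zero]
  have hrep : ∑ l ∈ weights d, c l * irrChar (orbitRep l) u v = 0 := by
    have h₁ (l : ℕ × ℕ) (hl : l ∈ weights d) : 3 * (c l * irrChar (orbitRep l) u v) =
        ∑ m ∈ weights 7, (if orbitRep m = m then if m = (3, 3) then 1 else 3 else 0 : ℤ) *
          irrChar m u v * (c l * charFourierCoeff l m) := by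
      have hl₇ := weights_mono hd hl
      calc
        _ = ∑ m ∈ weights 7, ((if orbitRep l = m then 3 else 0 : ℤ) : ℂ) *
            (c l * irrChar m u v) := by
          rw [Finset.sum_eq_single_of_mem _ (orbitRep_mem_weights l hl₇)]
          · simp
          · intro m _ hm
            simp [hm.symm]
        _ = _ := by
          refine Finset.sum_congr rfl fun m hm => ?_
          rw [orbitRep_indicator l hl₇ m hm, Int.cast_mul]
          ring
    refine (mul_eq_zero_iff_left (three_ne_zero (α := ℂ))).1 ?_
    rw [Finset.mul_sum, Finset.sum_congr rfl h₁, Finset.sum_comm]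
    refine Finset.sum_eq_zero fun m _ => ?_
    rw [← Finset.mul_sum, key, mul_zero]
  simp only [hc', orbitDiff, mul_sub, Finset.sum_sub_distrib, hrep, sub_zero]

/-! ### The product of the lines -/

/-- The linear form of the line of the arrangement with parameter `t`. -/
noncomputable def lineForm (t : ℂ) : MvPolynomial (Fin 3) ℂ :=
  C (t ^ 2) * (X 0 + C Complex.I * X 1) - C t * (X 0 - C Complex.I * X 1) - C (t ^ 3 - 1) * X 2

/-- The product of the linear forms of the twelve lines. -/
noncomputable def lineProduct : MvPolynomial (Fin 3) ℂ :=
  ∏ k ∈ Finset.range 12, lineForm (zeta ^ k)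

theorem lineForm_mem_mP {k : ℕ} {P : ℝ × ℝ} (h : P ∈ boLine 12 k) :
    lineForm (zeta ^ k) ∈ mP P := by
  rw [mem_boLine_twelve_iff] at h
  generalize zeta ^ k = t at *
  refine Ideal.mem_span_pair.2 ⟨C (t ^ 2 - t), C ((t ^ 2 + t) * Complex.I), ?_⟩
  rw [lineForm, ← h]
  simp only [map_sub, map_add, map_mul, map_pow]
  ring

theorem lineProduct_mem_mP_pow {P : ℝ × ℝ} (hP : P ∈ tripleSet 12) :
    lineProduct ∈ mP P ^ 3 := by
  classical
  rw [lineProduct, ← Finset.prod_filter_mul_prod_filter_not _ (fun k => P ∈ boLine 12 k)]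
  refine Ideal.mul_mem_right _ _ (Ideal.pow_le_pow_right (n := ((Finset.range 12).filter
    fun k => P ∈ boLine 12 k).card) ?_ ?_)
  · rw [← Set.ncard_coe_finset]
    simpa [tripleSet] using hP
  · rw [← Finset.prod_const]
    exact Ideal.prod_mem_prod fun k hk => lineForm_mem_mP (Finset.mem_filter.1 hk).2

/-- The equation of the line with parameter `t` in the coordinates `u = x + iy`, `v = x - iy`. -/
noncomputable def lineEquation (u v t : ℂ) : ℂ := t ^ 2 * u - t * v - (t ^ 3 - 1)

theorem restrictLine_lineForm (u v t : ℂ) :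
    restrictLine u v (lineForm t) = Polynomial.C (lineEquation u v t) * Polynomial.X := by
  have h : lineEquation u v t = t ^ 2 * ((u + v) / 2 + Complex.I * ((u - v) / (2 * Complex.I))) -
      t * ((u + v) / 2 - Complex.I * ((u - v) / (2 * Complex.I))) - (t ^ 3 - 1) := by
    rw [lineEquation]
    field_simp
    ring
  rw [h]
  simp only [lineForm, map_sub, map_add, map_mul, restrictLine_X_zero, restrictLine_X_one,
    restrictLine_X_two, restrictLine_C]
  ring

/-- One step of Graeffe's root squaring. -/
theorem prod_lineEquation_double {z : ℂ} {n : ℕ} (h : z ^ n = -1) (u v : ℂ) :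
    ∏ k ∈ Finset.range (n + n), lineEquation u v (z ^ k) =
      ∏ k ∈ Finset.range n, lineEquation (u ^ 2 - 2 * v) (v ^ 2 - 2 * u) ((z ^ 2) ^ k) := by
  rw [Finset.prod_range_add, ← Finset.prod_mul_distrib]
  refine Finset.prod_congr rfl fun k _ => ?_
  rw [pow_add, h, ← pow_mul, mul_comm 2 k, pow_mul]
  simp only [lineEquation]
  ring

/-- The difference of the cubes of the coordinates obtained from `u`, `v` by squaring roots twice:
the equation of the union of the lines. -/
def arrangementEquation {R : Type*} [CommRing R] (u v : R) : R :=
  ((u ^ 2 - 2 * v) ^ 2 - 2 * (v ^ 2 - 2 * u)) ^ 3 - ((v ^ 2 - 2 * u) ^ 2 - 2 * (u ^ 2 - 2 * v)) ^ 3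

theorem prod_lineEquation (u v : ℂ) :
    ∏ k ∈ Finset.range 12, lineEquation u v (zeta ^ k) = arrangementEquation u v := by
  have h₆ : zeta ^ 6 = -1 :=
    (isPrimitiveRoot_zeta.pow (by norm_num) (by norm_num : 12 = 6 * 2)).eq_neg_one_of_two_right
  have h₃ : (zeta ^ 2) ^ 3 = -1 := by rw [← h₆]; ring
  have hω : 1 + zeta ^ 4 + (zeta ^ 4) ^ 2 = 0 := by
    have h := (isPrimitiveRoot_zeta.pow (by norm_num)
      (by norm_num : 12 = 4 * 3)).geom_sum_eq_zero (by norm_num)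
    simpa [Finset.sum_range_succ] using h
  rw [prod_lineEquation_double (n := 6) h₆, prod_lineEquation_double (n := 3) h₃,
    arrangementEquation, ← pow_mul]
  generalize zeta ^ 4 = w at hω
  generalize (u ^ 2 - 2 * v) ^ 2 - 2 * (v ^ 2 - 2 * u) = a
  generalize (v ^ 2 - 2 * u) ^ 2 - 2 * (u ^ 2 - 2 * v) = b
  have h₂ : w ^ 2 = -1 - w := by linear_combination hω
  have hw₃ : w ^ 3 = 1 := by linear_combination (w - 1) * hω
  simp only [Finset.prod_range_succ, Finset.prod_range_zero, lineEquation, pow_zero, pow_one,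
    h₂, hw₃]
  have h₅ : (-1 - w) ^ 3 = 1 := by rw [← h₂, ← pow_mul, mul_comm, pow_mul, hw₃, one_pow]
  have h₄ : (-1 - w) ^ 2 = w := by linear_combination hω
  rw [h₄, h₅]
  linear_combination (a - b) * (-a * b - (a ^ 2 + b ^ 2 + a * b)) * hω

theorem coeff_restrictLine_lineProduct (u v : ℂ) :
    (restrictLine u v lineProduct).coeff 12 = arrangementEquation u v := by
  rw [lineProduct, map_prod]
  simp only [restrictLine_lineForm]
  rw [Finset.prod_mul_distrib, ← map_prod, prod_lineEquation, Finset.prod_const,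
    Finset.card_range, Polynomial.coeff_C_mul_X_pow, if_pos rfl]

theorem certSum_arrangementEquation_ne_zero : certSum (arrangementEquation (R := ℤ)) ≠ 0 := by
  decide +kernel

/-! ### The functional on the square of the ideal -/

theorem certSum_coeff_mul_coeff {f g : MvPolynomial (Fin 3) ℂ} (hf : f ∈ tripleIdeal)
    (hg : g ∈ tripleIdeal) {d : ℕ} (hd : d ∈ Finset.Icc 5 7) :
    (certSum fun u v => (restrictLine u v f).coeff d * (restrictLine u v g).coeff (12 - d)) =
      0 := by
  have hd' := Finset.mem_Icc.1 hd
  obtain ⟨a, ha⟩ := exists_coeff_eq_sum_orbitDiff hf hd'.2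
  obtain ⟨b, hb⟩ := exists_coeff_eq_sum_orbitDiff hg (d := 12 - d) (by omega)
  simp only [ha, hb, Finset.sum_mul_sum, mul_mul_mul_comm (a _), certSum_sum, certSum_const_mul]
  refine Finset.sum_eq_zero fun l hl => Finset.sum_eq_zero fun m hm => ?_
  rw [certSum_orbitDiff_mul hd hl hm, mul_zero]

theorem coeff_restrictLine_eq_zero {f : MvPolynomial (Fin 3) ℂ} (hf : f ∈ tripleIdeal) {d : ℕ}
    (hd : d ≤ 4) (u v : ℂ) : (restrictLine u v f).coeff d = 0 := by
  obtain ⟨c, hc⟩ := exists_coeff_eq_sum_orbitDiff hf (hd.trans (by norm_num))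
  rw [hc]
  refine Finset.sum_eq_zero fun l hl => ?_
  rw [orbitDiff, orbitRep_eq_self l (weights_mono hd hl), sub_self, mul_zero]

theorem certSum_coeff_mul {f g : MvPolynomial (Fin 3) ℂ} (hf : f ∈ tripleIdeal)
    (hg : g ∈ tripleIdeal) : (certSum fun u v => (restrictLine u v (f * g)).coeff 12) = 0 := by
  simp only [map_mul, Polynomial.coeff_mul, certSum_sum]
  refine Finset.sum_eq_zero fun ⟨d, e⟩ hde => ?_
  obtain rfl : e = 12 - d := by
    rw [Finset.HasAntidiagonal.mem_antidiagonal] at hde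
    omega
  by_cases h₄ : d ≤ 4
  · simp [coeff_restrictLine_eq_zero hf h₄, certSum]
  by_cases h₈ : 8 ≤ d
  · simp [coeff_restrictLine_eq_zero hg (d := 12 - d) (by omega), certSum]
  · exact certSum_coeff_mul_coeff hf hg (Finset.mem_Icc.2 (by omega))

theorem certSum_coeff_eq_zero_of_mem_sq {f : MvPolynomial (Fin 3) ℂ} (hf : f ∈ tripleIdeal ^ 2) :
    (certSum fun u v => (restrictLine u v f).coeff 12) = 0 := by
  rw [pow_two] at hf
  induction hf using Submodule.mul_induction_on' with
  | mem_mul_mem f hf g hg => exact certSum_coeff_mul hf hg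
  | add f _ g _ hf hg =>
    rw [← add_zero (0 : ℂ)]
    nth_rewrite 1 [← hf]
    rw [← hg]
    simp only [certSum, map_add, Polynomial.coeff_add, ← List.sum_map_add]
    congr 2
    ext
    ring

theorem lineProduct_notMem_sq : lineProduct ∉ tripleIdeal ^ 2 := by
  intro h
  have h₀ := certSum_coeff_eq_zero_of_mem_sq h
  simp only [coeff_restrictLine_lineProduct] at h₀
  rw [certSum_intCast arrangementEquation _ fun u v => by simp [arrangementEquation],
    Int.cast_eq_zero] at h₀
  exact certSum_arrangementEquation_ne_zero h₀

/-- For `n = 12`, the containment `I₁₂⁽³⁾ ⊆ I₁₂²` fails for the radical ideal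
`I₁₂ = ⋂_{P ∈ T₁₂} m_P` of the triple points of the Böröczky arrangement of `12` lines:
there is a polynomial lying in every `m_P³` but not in `I₁₂²`. -/
theorem boroczky_containment_fails_12 :
    ∃ F : MvPolynomial (Fin 3) ℂ,
      F ∈ (⨅ P ∈ tripleSet 12, (mP P) ^ 3) ∧
      F ∉ (⨅ P ∈ tripleSet 12, mP P) ^ 2 := by
  refine ⟨lineProduct, ?_, lineProduct_notMem_sq⟩
  simp only [Submodule.mem_iInf]
  exact fun P hP => lineProduct_mem_mP_pow hP
end

section
/- Let K be a field with char K ≠ 3, R = K[x,y,z], and let P₁,P₂,P₃,Q₁,Q₂,Q₃ ∈ R. Set f = P₂Q₃ − P₃Q₂, g = P₃Q₁ − P₁Q₃, h = P₁Q₂ − P₂Q₁, and I = ⟨f,g,h⟩. Assume f, g, h are homogeneous of the same degree d, that they minimally generate I, that the kernel of the map R³ → R, (a,b,c) ↦ af + bg + ch, is generated by (P₁,P₂,P₃) and (Q₁,Q₂,Q₃), and that I = ⋂_{P ∈ S} m_P is the radical ideal of a finite nonempty set S of points of the projective plane over K (where m_P is the homogeneous vanishing ideal of the point P). Define the third symbolic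 power I^{(3)} = ⋂_{P ∈ S} m_P³. Then I^{(3)} ⊆ I² if and only if there exist u₁, …, u₁₂ ∈ R such that f = P₁u₁ + P₂u₂ + P₃u₃ − Q₁u₇ − Q₂u₈ − Q₃u₉, g = P₁u₂ + P₂u₄ + P₃u₅ − Q₁u₈ − Q₂u₁₀ − Q₃u₁₁, and h = P₁u₃ + P₂u₅ + P₃u₆ − Q₁u₉ − Q₂u₁₁ − Q₃u₁₂ (i.e., the column vector (f,g,h)^T lies in the image of Y^T, where Y is the 12×3 matrix built from the Pᵢ and Qᵢ representing the last homomorphism in the minimal free resolution of I³). -/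
open MvPolynomial

/-- The homogeneous vanishing ideal of a point of the projective plane over `K` given by a
(nonzero) triple `p : Fin 3 → K`: the ideal generated by (equivalently, consisting of sums of)
the homogeneous polynomials vanishing at `p`. -/
noncomputable def projVanishingIdeal {K : Type*} [Field K] (p : Fin 3 → K) :
    Ideal (MvPolynomial (Fin 3) K) :=
  Ideal.span {F : MvPolynomial (Fin 3) K |
    (∃ d : ℕ, F.IsHomogeneous d) ∧ MvPolynomial.eval p F = 0}

namespace SeceleanuCriterion

section HomogeneousPolynomials

variable {σ R : Type*} [CommRing R]

theorem homogeneousComponent_add_mul {p : MvPolynomial σ R} {m : ℕ} (hp : p.IsHomogeneous m)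
    (x : MvPolynomial σ R) (n : ℕ) :
    homogeneousComponent (m + n) (p * x) = p * homogeneousComponent n x := by
  let _ : GradedAlgebra (homogeneousSubmodule σ R) := MvPolynomial.gradedAlgebra
  have h := DirectSum.coe_decompose_mul_add_of_left_mem (homogeneousSubmodule σ R) (i := m) (j := n)
    (a := p) (b := x) hp
  have key : ∀ (k : ℕ) (y : MvPolynomial σ R),
      (DirectSum.decompose (homogeneousSubmodule σ R) y k : MvPolynomial σ R) =
        homogeneousComponent k y := fun k y => decomposition.decompose'_apply y k
  rwa [key, key] at h

theorem aeval_mul_of_isHomogeneous {S : Type*} [CommRing S] [Algebra R S] (r : S) (g : σ → S)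
    {Φ : MvPolynomial σ R} {n : ℕ} (hΦ : Φ.IsHomogeneous n) :
    aeval (fun i => r * g i) Φ = r ^ n * aeval g Φ := by
  conv_lhs => rw [Φ.as_sum]
  conv_rhs => rw [Φ.as_sum]
  rw [map_sum, map_sum, Finset.mul_sum]
  refine Finset.sum_congr rfl fun s hs => ?_
  rw [aeval_monomial, aeval_monomial, Finsupp.prod, Finsupp.prod]
  simp_rw [mul_pow]
  rw [Finset.prod_mul_distrib, Finset.prod_pow_eq_pow_sum, ← hΦ.degree_eq_sum_deg_support hs]
  ring

/-- An algebra endomorphism congruent to scaling by `r` modulo `J` acts on forms of degree `n`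
as multiplication by `r ^ n`, modulo `J`. -/
theorem C_pow_mul_sub_mem {J : Ideal (MvPolynomial σ R)}
    (χ : MvPolynomial σ R →ₐ[R] MvPolynomial σ R) (r : R)
    (hχ : ∀ i, C r * X i - χ (X i) ∈ J) {Φ : MvPolynomial σ R} {n : ℕ}
    (hΦ : Φ.IsHomogeneous n) : C r ^ n * Φ - χ Φ ∈ J := by
  have h : (Ideal.Quotient.mkₐ R J).comp χ =
      (Ideal.Quotient.mkₐ R J).comp (aeval fun i => C r * X i) := by
    refine MvPolynomial.algHom_ext fun i => ?_
    simpa using (Ideal.Quotient.eq.mpr (hχ i)).symm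
  have h' := DFunLike.congr_fun h Φ
  rw [AlgHom.comp_apply, AlgHom.comp_apply, aeval_mul_of_isHomogeneous _ _ hΦ,
    aeval_X_left_apply] at h'
  exact Ideal.Quotient.eq.mp h'.symm

end HomogeneousPolynomials

section Detecting

variable {R : Type*} [CommRing R]

/-- An ideal of `R` detects divisibility if divisibility in `R[T₀, T₁, T₂]` may be tested after
multiplication by all its elements; this is a form of having grade at least two. -/
def DetectsDvd (J : Ideal R) : Prop :=
  ∀ ℓ Φ : MvPolynomial (Fin 3) R, (∀ r ∈ J, ℓ ∣ C r * Φ) → ℓ ∣ Φ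

theorem DetectsDvd.mono {J J' : Ideal R} (h : DetectsDvd J) (hJ : J ≤ J') : DetectsDvd J' :=
  fun ℓ Φ hΦ => h ℓ Φ fun r hr => hΦ r (hJ hr)

theorem DetectsDvd.mul {J J' : Ideal R} (h : DetectsDvd J) (h' : DetectsDvd J') :
    DetectsDvd (J * J') := fun ℓ Φ hΦ => h' ℓ Φ fun s hs => h ℓ _ fun r hr => by
  simpa [mul_assoc] using hΦ (r * s) (Ideal.mul_mem_mul hr hs)

theorem DetectsDvd.top : DetectsDvd (⊤ : Ideal R) := fun ℓ Φ hΦ => by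
  simpa using hΦ 1 trivial

theorem DetectsDvd.pow {J : Ideal R} (h : DetectsDvd J) (n : ℕ) : DetectsDvd (J ^ n) := by
  induction n with
  | zero => simpa using DetectsDvd.top
  | succ n ih => rw [pow_succ]; exact ih.mul h

theorem DetectsDvd.prod {ι : Type*} (s : Finset ι) {J : ι → Ideal R}
    (h : ∀ i ∈ s, DetectsDvd (J i)) : DetectsDvd (∏ i ∈ s, J i) :=
  Finset.prod_induction _ _ (fun _ _ => DetectsDvd.mul) (by simpa using DetectsDvd.top) h

theorem DetectsDvd.ne_bot [Nontrivial R] {J : Ideal R} (h : DetectsDvd J) : J ≠ ⊥ := by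
  rintro rfl
  have := h 0 1 (by simp)
  simp at this

/-- If a power of each generator multiplies `Φ` into a multiple of `ℓ`, then `ℓ` divides `Φ`. -/
theorem DetectsDvd.dvd_of_pow {F : Fin 3 → R} (h : DetectsDvd (Ideal.span (Set.range F))) (n : ℕ)
    {ℓ Φ : MvPolynomial (Fin 3) R} (hΦ : ∀ i, ℓ ∣ C (F i) ^ n * Φ) : ℓ ∣ Φ := by
  obtain ⟨N, hN⟩ : ∃ N, Ideal.span (Set.range F) ^ N ≤
      Ideal.span (Set.range fun i => F i ^ n) := by
    refine Ideal.exists_pow_le_of_le_radical_of_fg ?_ (Submodule.fg_span (Set.finite_range F))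
    rw [Ideal.span_le]
    rintro _ ⟨i, rfl⟩
    exact ⟨n, Ideal.subset_span ⟨i, rfl⟩⟩
  refine (h.pow N).mono hN ℓ Φ fun r hr => ?_
  induction hr using Submodule.span_induction with
  | mem x hx => obtain ⟨i, rfl⟩ := hx; simpa using hΦ i
  | zero => simp
  | add x y _ _ hx hy => rw [map_add, add_mul]; exact dvd_add hx hy
  | smul a x _ hx => rw [smul_eq_mul, map_mul, mul_assoc]; exact hx.mul_left _

end Detecting

section LinearForms

variable {R : Type*} [CommRing R]

/-- The linear form `∑ Pᵢ Tᵢ`. -/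
noncomputable def linearForm (P : Fin 3 → R) : MvPolynomial (Fin 3) R := ∑ i, C (P i) * X i

theorem linearForm_eq (P : Fin 3 → R) :
    linearForm P = C (P 0) * X 0 + C (P 1) * X 1 + C (P 2) * X 2 := by
  simp [linearForm, Fin.sum_univ_three]

theorem isHomogeneous_linearForm (P : Fin 3 → R) : (linearForm P).IsHomogeneous 1 :=
  IsHomogeneous.sum _ _ _ fun _ _ => isHomogeneous_C_mul_X _ _

theorem linearForm_eq_zero {P : Fin 3 → R} (h : linearForm P = 0) (i : Fin 3) : P i = 0 := by
  have := congrArg (aeval (Pi.single i 1 : Fin 3 → R)) h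
  fin_cases i <;> simpa [linearForm_eq] using this

/-- The entries of `F` are the `2 × 2` minors of the matrix with rows `P` and `Q`. -/
def IsMinors (P Q F : Fin 3 → R) : Prop :=
  F 0 = P 1 * Q 2 - P 2 * Q 1 ∧ F 1 = P 2 * Q 0 - P 0 * Q 2 ∧ F 2 = P 0 * Q 1 - P 1 * Q 0

variable {P Q F : Fin 3 → R}

theorem IsMinors.relation_mem (h : IsMinors P Q F) (i j : Fin 3) :
    C (F i) * X j - C (F j) * X i ∈ Ideal.span {linearForm P, linearForm Q} := by
  obtain ⟨h0, h1, h2⟩ := h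
  have key : ∀ k : Fin 3, C (Q k) * linearForm P - C (P k) * linearForm Q ∈
      Ideal.span {linearForm P, linearForm Q} := fun k =>
    Ideal.sub_mem _ (Ideal.mul_mem_left _ _ (Ideal.subset_span (by simp)))
      (Ideal.mul_mem_left _ _ (Ideal.subset_span (by simp)))
  have h01 : C (F 0) * X 1 - C (F 1) * X 0 ∈ Ideal.span {linearForm P, linearForm Q} := by
    convert key 2 using 1
    simp only [linearForm_eq, h0, h1, map_sub, map_mul]
    ring
  have h12 : C (F 1) * X 2 - C (F 2) * X 1 ∈ Ideal.span {linearForm P, linearForm Q} := by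
    convert key 0 using 1
    simp only [linearForm_eq, h1, h2, map_sub, map_mul]
    ring
  have h20 : C (F 2) * X 0 - C (F 0) * X 2 ∈ Ideal.span {linearForm P, linearForm Q} := by
    convert key 1 using 1
    simp only [linearForm_eq, h0, h2, map_sub, map_mul]
    ring
  fin_cases i <;> fin_cases j <;>
    first
    | simp; done
    | assumption
    | rw [← neg_sub]; exact neg_mem ‹_›

/-- The endomorphism `Tⱼ ↦ (P ⬝ c) Tⱼ - cⱼ p`, which kills the linear form `p = ∑ Pᵢ Tᵢ`. -/
noncomputable def shear (P c : Fin 3 → R) : MvPolynomial (Fin 3) R →ₐ[R] MvPolynomial (Fin 3) R :=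
  aeval fun j => C (P ⬝ᵥ c) * X j - C (c j) * linearForm P

theorem shear_linearForm (P Q c : Fin 3 → R) :
    shear P c (linearForm Q) = C (P ⬝ᵥ c) * linearForm Q - C (Q ⬝ᵥ c) * linearForm P := by
  simp only [shear, linearForm_eq, dotProduct, Fin.sum_univ_three, map_add, map_mul, aeval_X,
    algHom_C, algebraMap_eq]
  ring

theorem shear_congr (P c : Fin 3 → R) {Φ : MvPolynomial (Fin 3) R} {n : ℕ}
    (hΦ : Φ.IsHomogeneous n) : linearForm P ∣ C (P ⬝ᵥ c) ^ n * Φ - shear P c Φ := by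
  rw [← Ideal.mem_span_singleton]
  refine C_pow_mul_sub_mem _ _ (fun i => ?_) hΦ
  rw [Ideal.mem_span_singleton]
  exact ⟨C (c i), by simp only [shear, aeval_X]; ring⟩

theorem IsMinors.dvd_pow_mul [IsDomain R] (h : IsMinors P Q F) {μ ν : MvPolynomial (Fin 3) R}
    {n : ℕ} (hν : ν.IsHomogeneous n) (hμν : linearForm P * μ + linearForm Q * ν = 0) (i : Fin 3) :
    linearForm P ∣ C (F i) ^ (n + 1) * ν := by
  obtain ⟨c, hPc, hQc⟩ : ∃ c : Fin 3 → R, P ⬝ᵥ c = F i ∧ Q ⬝ᵥ c = 0 := by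
    obtain ⟨h0, h1, h2⟩ := h
    fin_cases i
    · exact ⟨![0, Q 2, -Q 1], by simp [dotProduct, Fin.sum_univ_three, h0]; ring,
        by simp [dotProduct, Fin.sum_univ_three]; ring⟩
    · exact ⟨![-Q 2, 0, Q 0], by simp [dotProduct, Fin.sum_univ_three, h1]; ring,
        by simp [dotProduct, Fin.sum_univ_three]; ring⟩
    · exact ⟨![Q 1, -Q 0, 0], by simp [dotProduct, Fin.sum_univ_three, h2]; ring,
        by simp [dotProduct, Fin.sum_univ_three]; ring⟩
  by_cases hF : F i = 0
  · simp [hF]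
  have hq : linearForm Q ≠ 0 := fun hq => hF <| by
    have := linearForm_eq_zero hq
    obtain ⟨h0, h1, h2⟩ := h
    fin_cases i <;> simp_all
  have hχ : shear P c ν = 0 := by
    have := congrArg (shear P c) hμν
    rw [map_add, map_mul, map_mul, shear_linearForm, shear_linearForm, hQc, hPc] at this
    simpa [hF, hq] using this
  have := shear_congr P c hν
  rw [hχ, hPc, sub_zero] at this
  rw [pow_succ', mul_assoc]
  exact this.mul_left _

theorem IsMinors.linearForm_ne_zero [Nontrivial R] (h : IsMinors P Q F)
    (hF : DetectsDvd (Ideal.span (Set.range F))) : linearForm P ≠ 0 ∧ linearForm Q ≠ 0 := by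
  obtain ⟨h0, h1, h2⟩ := h
  constructor
  all_goals
    intro h
    refine hF.ne_bot ?_
    have := linearForm_eq_zero h
    rw [Ideal.span_eq_bot]
    rintro _ ⟨i, rfl⟩
    fin_cases i <;> simp_all

/-- The only syzygies of the two linear forms are the Koszul ones. -/
theorem IsMinors.exists_eq_mul [IsDomain R] (h : IsMinors P Q F)
    (hF : DetectsDvd (Ideal.span (Set.range F))) {μ ν : MvPolynomial (Fin 3) R}
    (hμν : linearForm P * μ + linearForm Q * ν = 0) :
    ∃ w, μ = linearForm Q * w ∧ ν = -(linearForm P * w) := by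
  have hp := (h.linearForm_ne_zero hF).1
  have hdvd : linearForm P ∣ ν := by
    rw [← sum_homogeneousComponent ν]
    refine Finset.dvd_sum fun n _ => ?_
    refine hF.dvd_of_pow (n + 1) fun i => h.dvd_pow_mul (μ := homogeneousComponent n μ)
      (homogeneousComponent_isHomogeneous n ν) ?_ i
    have := congrArg (homogeneousComponent (1 + n)) hμν
    rwa [map_add, homogeneousComponent_add_mul (isHomogeneous_linearForm P),
      homogeneousComponent_add_mul (isHomogeneous_linearForm Q), map_zero] at this
  obtain ⟨w, rfl⟩ := hdvd
  exact ⟨-w, mul_left_cancel₀ hp (by linear_combination hμν), by ring⟩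

/-- A form vanishing at `F` is killed by a power of each `Fᵢ` modulo the two linear forms. -/
theorem IsMinors.pow_mul_mem (h : IsMinors P Q F) {Φ : MvPolynomial (Fin 3) R} {n : ℕ}
    (hΦ : Φ.IsHomogeneous n) (hΦF : eval F Φ = 0) (i : Fin 3) :
    C (F i) ^ n * Φ ∈ Ideal.span {linearForm P, linearForm Q} := by
  have hχ := C_pow_mul_sub_mem (aeval fun j => X i * C (F j)) (F i) (fun j => by
    rw [aeval_X, mul_comm (X i)]
    exact h.relation_mem i j) hΦ
  have h0 : aeval (fun j => (C (F j) : MvPolynomial (Fin 3) R)) Φ = 0 := by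
    have := aeval_algebraMap_apply (MvPolynomial (Fin 3) R) F Φ
    rwa [algebraMap_eq, show aeval F Φ = eval F Φ from rfl, hΦF, map_zero] at this
  rwa [aeval_mul_of_isHomogeneous _ _ hΦ, h0, mul_zero, sub_zero] at hχ

theorem DetectsDvd.pow_mul_mem (hF : DetectsDvd (Ideal.span (Set.range F)))
    {Φ : MvPolynomial (Fin 3) R} {n m : ℕ} (hΦ : Φ.IsHomogeneous n)
    (h : ∀ i, C (F i) ^ m * Φ ∈ Ideal.span {linearForm P, linearForm Q}) (i : Fin 3) :
    C (P i) ^ n * Φ ∈ Ideal.span {linearForm P, linearForm Q} := by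
  set c : Fin 3 → R := Pi.single i 1
  have hPc : P ⬝ᵥ c = P i := by simp [c]
  have hmem : ∀ x, linearForm P ∣ x → x ∈ Ideal.span {linearForm P, linearForm Q} := by
    rintro _ ⟨x, rfl⟩
    exact Ideal.mul_mem_right _ _ (Ideal.subset_span (by simp))
  have hdvd : shear P c (linearForm Q) ∣ shear P c Φ := hF.dvd_of_pow m fun j => by
    obtain ⟨μ, ν, hμν⟩ := Ideal.mem_span_pair.1 (h j)
    have := congrArg (shear P c) hμν
    rw [map_add, map_mul, map_mul, map_mul, map_pow, algHom_C, algebraMap_eq,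
      shear_linearForm P P, sub_self, mul_zero, zero_add] at this
    exact ⟨_, by rw [← this, mul_comm]⟩
  obtain ⟨Ψ, hΨ⟩ := hdvd
  have hχ : shear P c Φ ∈ Ideal.span {linearForm P, linearForm Q} := by
    rw [hΨ, shear_linearForm]
    exact Ideal.mul_mem_right _ _ (Ideal.sub_mem _
      (Ideal.mul_mem_left _ _ (Ideal.subset_span (by simp)))
      (Ideal.mul_mem_left _ _ (Ideal.subset_span (by simp))))
  have := Ideal.add_mem _ (hmem _ (shear_congr P c hΦ)) hχ
  rwa [sub_add_cancel, hPc] at this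

end LinearForms

section Koszul

/-- The exactness properties of the Koszul complex of `a 0, a 1, a 2` used below. -/
structure IsKoszulExact {A : Type*} [CommRing A] (a : Fin 3 → A) : Prop where
  ne_zero : a 0 ≠ 0
  pair : ∀ α β, a 0 * α = a 1 * β → ∃ ε, α = a 1 * ε ∧ β = a 0 * ε
  triple : ∀ α β γ, a 0 * α + a 1 * β + a 2 * γ = 0 → ∃ κ₀ κ₁ κ₂,
    α = a 1 * κ₂ - a 2 * κ₁ ∧ β = a 2 * κ₀ - a 0 * κ₂ ∧ γ = a 0 * κ₁ - a 1 * κ₀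

/-- A Koszul-exact sequence detects membership in an ideal generated by two elements having only
Koszul syzygies. -/
theorem IsKoszulExact.mem_span_pair {A : Type*} [CommRing A] [IsDomain A] {a : Fin 3 → A}
    (ha : IsKoszulExact a) {p q : A} (hq : q ≠ 0)
    (hpq : ∀ μ ν, p * μ + q * ν = 0 → ∃ w, μ = q * w ∧ ν = -(p * w)) {Φ : A}
    (hΦ : ∀ i, a i * Φ ∈ Ideal.span {p, q}) : Φ ∈ Ideal.span {p, q} := by
  obtain ⟨μ₀, ν₀, h0⟩ := Ideal.mem_span_pair.1 (hΦ 0)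
  obtain ⟨μ₁, ν₁, h1⟩ := Ideal.mem_span_pair.1 (hΦ 1)
  obtain ⟨μ₂, ν₂, h2⟩ := Ideal.mem_span_pair.1 (hΦ 2)
  obtain ⟨w₂, hμ₂, hν₂⟩ := hpq (a 1 * μ₀ - a 0 * μ₁) (a 1 * ν₀ - a 0 * ν₁)
    (by linear_combination a 1 * h0 - a 0 * h1)
  obtain ⟨w₀, hμ₀, hν₀⟩ := hpq (a 2 * μ₁ - a 1 * μ₂) (a 2 * ν₁ - a 1 * ν₂)
    (by linear_combination a 2 * h1 - a 1 * h2)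
  obtain ⟨w₁, hμ₁, hν₁⟩ := hpq (a 0 * μ₂ - a 2 * μ₀) (a 0 * ν₂ - a 2 * ν₀)
    (by linear_combination a 0 * h2 - a 2 * h0)
  obtain ⟨κ₀, κ₁, κ₂, -, -, hw⟩ := ha.triple w₀ w₁ w₂
    (mul_left_cancel₀ hq (by linear_combination -a 0 * hμ₀ - a 1 * hμ₁ - a 2 * hμ₂))
  obtain ⟨ε, -, hε⟩ := ha.pair (μ₁ + q * κ₁) (μ₀ + q * κ₀)
    (by linear_combination -hμ₂ - q * hw)
  obtain ⟨η, -, hη⟩ := ha.pair (ν₁ - p * κ₁) (ν₀ - p * κ₀)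
    (by linear_combination -hν₂ + p * hw)
  refine Ideal.mem_span_pair.2 ⟨ε, η, mul_left_cancel₀ ha.ne_zero ?_⟩
  linear_combination h0 - p * hε - q * hη

end Koszul

section Homogeneous

variable {R : Type*} [CommRing R] {P Q F x : Fin 3 → R}

theorem exists_isHomogeneous_of_mem_span {Φ : MvPolynomial (Fin 3) R} {n : ℕ}
    (hΦ : Φ.IsHomogeneous (1 + n)) (h : Φ ∈ Ideal.span {linearForm P, linearForm Q}) :
    ∃ σ τ : MvPolynomial (Fin 3) R, σ.IsHomogeneous n ∧ τ.IsHomogeneous n ∧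
      Φ = linearForm P * σ + linearForm Q * τ := by
  obtain ⟨μ, ν, h⟩ := Ideal.mem_span_pair.1 h
  refine ⟨_, _, homogeneousComponent_isHomogeneous n μ, homogeneousComponent_isHomogeneous n ν, ?_⟩
  rw [← homogeneousComponent_add_mul (isHomogeneous_linearForm P),
    ← homogeneousComponent_add_mul (isHomogeneous_linearForm Q), ← map_add,
    mul_comm _ μ, mul_comm _ ν, h, homogeneousComponent_eq_self hΦ]

theorem exists_isHomogeneous_of_mem_map {Φ : MvPolynomial (Fin 3) R} {n : ℕ}
    (hΦ : Φ.IsHomogeneous n) (h : Φ ∈ (Ideal.span (Set.range x)).map C) :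
    ∃ σ : Fin 3 → MvPolynomial (Fin 3) R, (∀ i, (σ i).IsHomogeneous n) ∧
      Φ = C (x 0) * σ 0 + C (x 1) * σ 1 + C (x 2) * σ 2 := by
  rw [Ideal.map_span, ← Set.range_comp, Ideal.mem_span_range_iff_exists_fun] at h
  obtain ⟨c, hc⟩ := h
  refine ⟨fun i => homogeneousComponent n (c i),
    fun i => homogeneousComponent_isHomogeneous n _, ?_⟩
  rw [← homogeneousComponent_C_mul, ← homogeneousComponent_C_mul, ← homogeneousComponent_C_mul,
    ← map_add, ← map_add]
  conv_lhs => rw [← homogeneousComponent_eq_self hΦ, ← hc]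
  simp [Fin.sum_univ_three, mul_comm]

theorem IsKoszulExact.triple_isHomogeneous
    (hx : IsKoszulExact fun i => (C (x i) : MvPolynomial (Fin 3) R))
    {α β γ : MvPolynomial (Fin 3) R} {n : ℕ} (hα : α.IsHomogeneous n) (hβ : β.IsHomogeneous n)
    (hγ : γ.IsHomogeneous n) (h : C (x 0) * α + C (x 1) * β + C (x 2) * γ = 0) :
    ∃ κ : Fin 3 → MvPolynomial (Fin 3) R, (∀ i, (κ i).IsHomogeneous n) ∧
      α = C (x 1) * κ 2 - C (x 2) * κ 1 ∧ β = C (x 2) * κ 0 - C (x 0) * κ 2 ∧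
      γ = C (x 0) * κ 1 - C (x 1) * κ 0 := by
  obtain ⟨κ₀, κ₁, κ₂, h0, h1, h2⟩ := hx.triple α β γ h
  refine ⟨fun i => homogeneousComponent n (![κ₀, κ₁, κ₂] i),
    fun i => homogeneousComponent_isHomogeneous n _, ?_, ?_, ?_⟩
  · simpa [homogeneousComponent_eq_self hα] using congrArg (homogeneousComponent n) h0
  · simpa [homogeneousComponent_eq_self hβ] using congrArg (homogeneousComponent n) h1
  · simpa [homogeneousComponent_eq_self hγ] using congrArg (homogeneousComponent n) h2

end Homogeneous

section Derivation

variable {R : Type*} [CommRing R]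

/-- The derivation `∑ Fᵢ ∂/∂Tᵢ`. -/
noncomputable def directional (F : Fin 3 → R) :
    Derivation R (MvPolynomial (Fin 3) R) (MvPolynomial (Fin 3) R) :=
  ∑ i, (C (F i) : MvPolynomial (Fin 3) R) • pderiv i

theorem directional_apply (F : Fin 3 → R) (Φ : MvPolynomial (Fin 3) R) :
    directional F Φ = ∑ i, C (F i) * pderiv i Φ := by
  simp [directional, Fin.sum_univ_three]

theorem directional_linearForm (F P : Fin 3 → R) :
    directional F (linearForm P) = C (F ⬝ᵥ P) := by
  simp [directional_apply, linearForm_eq, Fin.sum_univ_three, dotProduct, Pi.single_apply]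

theorem isHomogeneous_directional (F : Fin 3 → R) {Φ : MvPolynomial (Fin 3) R} {n : ℕ}
    (hΦ : Φ.IsHomogeneous (n + 1)) : (directional F Φ).IsHomogeneous n := by
  rw [directional_apply]
  exact IsHomogeneous.sum _ _ _ fun i _ => hΦ.pderiv.C_mul _

theorem eval_directional (F : Fin 3 → R) {Φ : MvPolynomial (Fin 3) R} {n : ℕ}
    (hΦ : Φ.IsHomogeneous n) : eval F (directional F Φ) = n * eval F Φ := by
  have := congrArg (eval F) hΦ.sum_X_mul_pderiv
  simpa [directional_apply] using this

theorem directional_C_mul (F : Fin 3 → R) (r : R) (Φ : MvPolynomial (Fin 3) R) :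
    directional F (C r * Φ) = C r * directional F Φ := by
  rw [← smul_eq_C_mul, Derivation.map_smul, smul_eq_C_mul]

variable {P Q F : Fin 3 → R}

theorem IsMinors.dotProduct_eq_zero (h : IsMinors P Q F) : F ⬝ᵥ P = 0 ∧ F ⬝ᵥ Q = 0 := by
  obtain ⟨h0, h1, h2⟩ := h
  constructor <;> simp only [dotProduct, Fin.sum_univ_three, h0, h1, h2] <;> ring

theorem directional_linearForm_mul (h : F ⬝ᵥ P = 0) (Φ : MvPolynomial (Fin 3) R) :
    directional F (linearForm P * Φ) = linearForm P * directional F Φ := by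
  rw [Derivation.leibniz, directional_linearForm, h]
  simp

theorem eval_linearForm (F P : Fin 3 → R) : eval F (linearForm P) = F ⬝ᵥ P := by
  simp [linearForm_eq, dotProduct, Fin.sum_univ_three, mul_comm]

theorem exists_eq_linearForm {Φ : MvPolynomial (Fin 3) R} (hΦ : Φ.IsHomogeneous 1) :
    ∃ w, Φ = linearForm w := by
  have hc : ∀ i, pderiv i Φ = C (coeff 0 (pderiv i Φ)) := fun i =>
    totalDegree_eq_zero_iff_eq_C.1 (Nat.le_zero.1 hΦ.pderiv.totalDegree_le)
  refine ⟨fun i => coeff 0 (pderiv i Φ), ?_⟩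
  have := hΦ.sum_X_mul_pderiv
  rw [one_smul] at this
  conv_lhs => rw [← this]
  refine Finset.sum_congr rfl fun i _ => ?_
  rw [mul_comm, hc i]

end Derivation

section SymmetricImage

variable {R : Type*} [CommRing R]

/-- The image of `(U, V) ↦ U P + V Q` on pairs of symmetric matrices. -/
def symmImage (P Q : Fin 3 → R) : Submodule R (Fin 3 → R) where
  carrier := {v | ∃ U V : Matrix (Fin 3) (Fin 3) R, U.IsSymm ∧ V.IsSymm ∧
    v = U.mulVec P + V.mulVec Q}
  zero_mem' := ⟨0, 0, Matrix.isSymm_zero, Matrix.isSymm_zero, by simp⟩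
  add_mem' := by
    rintro _ _ ⟨U, V, hU, hV, rfl⟩ ⟨U', V', hU', hV', rfl⟩
    exact ⟨U + U', V + V', hU.add hU', hV.add hV', by simp only [Matrix.add_mulVec]; abel⟩
  smul_mem' := by
    rintro c _ ⟨U, V, hU, hV, rfl⟩
    exact ⟨c • U, c • V, hU.smul c, hV.smul c, by simp only [Matrix.smul_mulVec, smul_add]⟩

variable {P Q : Fin 3 → R}

theorem symmImage_comm (P Q : Fin 3 → R) : symmImage P Q = symmImage Q P := by
  refine le_antisymm ?_ ?_ <;>
  · rintro _ ⟨U, V, hU, hV, rfl⟩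
    exact ⟨V, U, hV, hU, add_comm _ _⟩

theorem mulVec_mem_symmImage {U : Matrix (Fin 3) (Fin 3) R} (hU : U.IsSymm) :
    U.mulVec P ∈ symmImage P Q :=
  ⟨U, 0, hU, Matrix.isSymm_zero, by simp⟩

theorem sq_single_mem_symmImage (i k : Fin 3) : Pi.single k (P i ^ 2) ∈ symmImage P Q := by
  have h := mulVec_mem_symmImage (P := P) (Q := Q)
    (U := Matrix.single k i (P i) + Matrix.single i k (P i) - Matrix.single i i (P k)) (by
      rw [Matrix.IsSymm, Matrix.transpose_sub, Matrix.transpose_add, Matrix.transpose_single,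
        Matrix.transpose_single, Matrix.transpose_single, add_comm (Matrix.single i k (P i))])
  convert h using 1
  rw [Matrix.sub_mulVec, Matrix.add_mulVec, Matrix.single_mulVec, Matrix.single_mulVec,
    Matrix.single_mulVec]
  ext j
  simp [Pi.single_apply, Function.update_apply]
  split_ifs <;> ring

/-- The coefficients of the quadratic form `(∑ Pᵢ Tᵢ) (∑ wᵢ Tᵢ)` lie in `J`. -/
theorem linearForm_mul_mem_map_iff {J : Ideal R} (w : Fin 3 → R) :
    linearForm P * linearForm w ∈ J.map C ↔
      ∀ U : Matrix (Fin 3) (Fin 3) R, U.IsSymm → U.mulVec P ⬝ᵥ w ∈ J := by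
  constructor
  · intro h U hU
    have hev : ∀ t : Fin 3 → R, (t ⬝ᵥ P) * (t ⬝ᵥ w) ∈ J := fun t => by
      have := Ideal.mem_map_of_mem (eval t) h
      rw [Ideal.map_map, map_mul, eval_linearForm, eval_linearForm] at this
      convert this
      rw [show (eval t).comp C = RingHom.id R from RingHom.ext fun r => eval_C r, Ideal.map_id]
    have h0 := hev ![1, 0, 0]
    have h1 := hev ![0, 1, 0]
    have h2 := hev ![0, 0, 1]
    have h01 := hev ![1, 1, 0]
    have h12 := hev ![0, 1, 1]
    have h02 := hev ![1, 0, 1]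
    have e01 := hU.apply 0 1
    have e02 := hU.apply 0 2
    have e12 := hU.apply 1 2
    simp only [dotProduct, Fin.sum_univ_three, Matrix.cons_val, one_mul, zero_mul, add_zero,
      zero_add] at h0 h1 h2 h01 h12 h02
    simp only [dotProduct, Fin.sum_univ_three, Matrix.mulVec, e01, e02, e12]
    have := J.add_mem (J.add_mem (J.add_mem (J.mul_mem_left (U 0 0 - U 0 1 - U 0 2) h0)
      (J.mul_mem_left (U 1 1 - U 0 1 - U 1 2) h1))
      (J.add_mem (J.mul_mem_left (U 2 2 - U 0 2 - U 1 2) h2) (J.mul_mem_left (U 0 1) h01)))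
      (J.add_mem (J.mul_mem_left (U 1 2) h12) (J.mul_mem_left (U 0 2) h02))
    convert this using 1
    ring
  · intro h
    have hs : ∀ i j, P i * w j + P j * w i ∈ J := fun i j => by
      have := h (Matrix.single i j 1 + Matrix.single j i 1) (by
        rw [Matrix.IsSymm, Matrix.transpose_add, Matrix.transpose_single,
          Matrix.transpose_single, add_comm])
      rw [Matrix.add_mulVec, Matrix.single_mulVec, Matrix.single_mulVec, add_dotProduct] at this
      convert this using 1
      simp [dotProduct, Function.update_apply]
      ring
    have hd : ∀ i, P i * w i ∈ J := fun i => by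
      have := h (Matrix.single i i 1) (by rw [Matrix.IsSymm, Matrix.transpose_single])
      rw [Matrix.single_mulVec] at this
      convert this using 1
      simp [dotProduct, Function.update_apply]
    have hC : ∀ r ∈ J, ∀ Φ : MvPolynomial (Fin 3) R, C r * Φ ∈ J.map C := fun r hr Φ =>
      Ideal.mul_mem_right _ _ (Ideal.mem_map_of_mem _ hr)
    have := add_mem (add_mem (add_mem (hC _ (hd 0) (X 0 ^ 2)) (hC _ (hd 1) (X 1 ^ 2)))
      (add_mem (hC _ (hd 2) (X 2 ^ 2)) (hC _ (hs 0 1) (X 0 * X 1))))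
      (add_mem (hC _ (hs 0 2) (X 0 * X 2)) (hC _ (hs 1 2) (X 1 * X 2)))
    convert this using 1
    simp only [linearForm_eq, map_add, map_mul]
    ring

end SymmetricImage

section Chase

variable {R : Type*} [CommRing R] [IsDomain R] {P Q F x : Fin 3 → R}

/-- The ideal generated by the minors is of linear type, provided that it detects divisibility and
that a Koszul-exact sequence lies in the radical of the ideal of entries of the matrix. -/
theorem IsMinors.mem_of_eval_eq_zero (h : IsMinors P Q F)
    (hF : DetectsDvd (Ideal.span (Set.range F)))
    (hx : ∀ N, IsKoszulExact fun i => (C (x i ^ N) : MvPolynomial (Fin 3) R))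
    (hxL : ∀ i, x i ∈ (Ideal.span (Set.range P ∪ Set.range Q)).radical)
    {Φ : MvPolynomial (Fin 3) R} {n : ℕ} (hΦ : Φ.IsHomogeneous n) (hΦF : eval F Φ = 0) :
    Φ ∈ Ideal.span {linearForm P, linearForm Q} := by
  set J := Ideal.span {linearForm P, linearForm Q} with hJ
  let T : Ideal R := (J.colon {Φ}).comap C
  have hT : ∀ r, r ∈ T ↔ C r * Φ ∈ J := fun r => by
    simp [T, Ideal.mem_comap, Submodule.mem_colon_singleton]
  have hLT : Ideal.span (Set.range P ∪ Set.range Q) ≤ T.radical := by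
    rw [Ideal.span_le]
    rintro _ (⟨i, rfl⟩ | ⟨i, rfl⟩) <;> refine ⟨n, (hT _).2 ?_⟩ <;> rw [map_pow]
    · exact hF.pow_mul_mem hΦ (h.pow_mul_mem hΦ hΦF) i
    · rw [hJ, Set.pair_comm]
      refine hF.pow_mul_mem hΦ (m := n) ?_ i
      rw [Set.pair_comm]
      exact h.pow_mul_mem hΦ hΦF
  have hxT : ∀ i, x i ∈ T.radical := fun i => Ideal.radical_le_radical_iff.2 hLT (hxL i)
  choose k hk using hxT
  refine (hx (k 0 + k 1 + k 2)).mem_span_pair (h.linearForm_ne_zero hF).2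
    (fun μ ν => h.exists_eq_mul hF) fun i => (hT _).1 ?_
  refine Ideal.mem_of_dvd _ (pow_dvd_pow _ ?_) (hk i)
  fin_cases i <;> simp <;> omega

theorem mem_sq_of_mem_symmImage (h : IsMinors P Q F) (hF : DetectsDvd (Ideal.span (Set.range F)))
    (hlin : ∀ (n : ℕ) (Φ : MvPolynomial (Fin 3) R), Φ.IsHomogeneous n → eval F Φ = 0 →
      Φ ∈ Ideal.span {linearForm P, linearForm Q})
    (hx : IsKoszulExact fun i => (C (x i) : MvPolynomial (Fin 3) R)) (h3 : IsUnit (3 : R))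
    (hFM : F ∈ symmImage P Q) {G : R} (hG : ∀ i, x i * G ∈ Ideal.span (Set.range F) ^ 3) :
    G ∈ Ideal.span (Set.range F) ^ 2 := by
  obtain ⟨hFP, hFQ⟩ := h.dotProduct_eq_zero
  have hq := (h.linearForm_ne_zero hF).2
  have hkos := fun μ ν => h.exists_eq_mul hF (μ := μ) (ν := ν)
  have hDp := directional_linearForm_mul hFP
  have hDq := directional_linearForm_mul hFQ
  have hDC := directional_C_mul F
  have hx0 : x 0 ≠ 0 := fun h0 => hx.ne_zero (by simp [h0])
  simp only [Ideal.mem_span_pow_iff_exists_isHomogeneous] at hG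
  choose α hα hαG using hG
  have hrel : ∀ i j, ∃ σ τ : MvPolynomial (Fin 3) R, σ.IsHomogeneous 2 ∧ τ.IsHomogeneous 2 ∧
      C (x i) * α j - C (x j) * α i = linearForm P * σ + linearForm Q * τ := fun i j => by
    have hh : (C (x i) * α j - C (x j) * α i).IsHomogeneous (1 + 2) :=
      ((hα j).C_mul _).sub ((hα i).C_mul _)
    refine exists_isHomogeneous_of_mem_span hh (hlin _ _ hh ?_)
    rw [map_sub, map_mul, map_mul, eval_C, eval_C, hαG, hαG]
    ring
  obtain ⟨σ₀, τ₀, hσ₀, hτ₀, e₀⟩ := hrel 1 2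
  obtain ⟨σ₁, τ₁, hσ₁, hτ₁, e₁⟩ := hrel 2 0
  obtain ⟨σ₂, τ₂, hσ₂, hτ₂, e₂⟩ := hrel 0 1
  set a := (C (x 0) : MvPolynomial (Fin 3) R) with ha
  set b := (C (x 1) : MvPolynomial (Fin 3) R) with hb
  set c := (C (x 2) : MvPolynomial (Fin 3) R) with hc
  set p := linearForm P with hp
  set q := linearForm Q with hq'
  obtain ⟨W₀, hW₀, hW₀'⟩ := hkos (a * σ₀ + b * σ₁ + c * σ₂) (a * τ₀ + b * τ₁ + c * τ₂)
    (by linear_combination -a * e₀ - b * e₁ - c * e₂)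
  obtain ⟨w, hW, hW'⟩ : ∃ w, a * σ₀ + b * σ₁ + c * σ₂ = q * linearForm w ∧
      a * τ₀ + b * τ₁ + c * τ₂ = -(p * linearForm w) := by
    obtain ⟨w, hw⟩ := exists_eq_linearForm (homogeneousComponent_isHomogeneous 1 W₀)
    refine ⟨w, ?_, ?_⟩
    · rw [← hw, ← homogeneousComponent_add_mul (isHomogeneous_linearForm Q), ← hW₀,
        homogeneousComponent_eq_self (((hσ₀.C_mul _).add (hσ₁.C_mul _)).add (hσ₂.C_mul _))]
    · rw [← hw, ← homogeneousComponent_add_mul (isHomogeneous_linearForm P), ← map_neg, ← hW₀',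
        homogeneousComponent_eq_self (((hτ₀.C_mul _).add (hτ₁.C_mul _)).add (hτ₂.C_mul _))]
  have hJ : ∀ σ₀ σ₁ σ₂ : MvPolynomial (Fin 3) R, a * σ₀ + b * σ₁ + c * σ₂ ∈
      (Ideal.span (Set.range x)).map C := fun σ₀ σ₁ σ₂ => by
    have hxC : ∀ i, C (x i) ∈ (Ideal.span (Set.range x)).map (C : R →+* MvPolynomial (Fin 3) R) :=
      fun i => Ideal.mem_map_of_mem _ (Ideal.subset_span ⟨i, rfl⟩)
    exact add_mem (add_mem (Ideal.mul_mem_right _ _ (hxC 0)) (Ideal.mul_mem_right _ _ (hxC 1)))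
      (Ideal.mul_mem_right _ _ (hxC 2))
  have hFw : F ⬝ᵥ w ∈ Ideal.span (Set.range x) := by
    obtain ⟨U, V, hU, hV, hUV⟩ := hFM
    rw [hUV, add_dotProduct]
    refine add_mem ((linearForm_mul_mem_map_iff w).1 ?_ U hU)
      ((linearForm_mul_mem_map_iff w).1 ?_ V hV)
    · rw [← neg_neg (_ * _), ← hp, ← hW']
      exact neg_mem (hJ _ _ _)
    · rw [← hq', ← hW]
      exact hJ _ _ _
  obtain ⟨t, ht⟩ := Ideal.mem_span_range_iff_exists_fun.1 hFw
  have hDW : directional F (linearForm w) = a * C (t 0) + b * C (t 1) + c * C (t 2) := by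
    rw [directional_linearForm, ← ht, Fin.sum_univ_three]
    simp only [map_add, map_mul]
    ring
  have hDσ := congrArg (directional F) hW
  have hDτ := congrArg (directional F) hW'
  rw [map_neg, hDp, hDW] at hDτ
  rw [hDq, hDW] at hDσ
  simp only [map_add, ha, hb, hc, hDC] at hDσ hDτ
  obtain ⟨κ₀, κ₁, κ₂, k₀, k₁, k₂⟩ := hx.triple (directional F σ₀ - q * C (t 0))
    (directional F σ₁ - q * C (t 1)) (directional F σ₂ - q * C (t 2))
    (by linear_combination hDσ)
  obtain ⟨η₀, η₁, η₂, l₀, l₁, l₂⟩ := hx.triple (directional F τ₀ + p * C (t 0))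
    (directional F τ₁ + p * C (t 1)) (directional F τ₂ + p * C (t 2))
    (by linear_combination hDτ)
  have hDe := congrArg (directional F) e₂
  rw [map_sub, map_add, hDp, hDq, hDC, hDC] at hDe
  obtain ⟨ε, -, hε⟩ := hx.pair (directional F (α 1) - p * κ₁ - q * η₁)
    (directional F (α 0) - p * κ₀ - q * η₀) (by linear_combination hDe + p * k₂ + q * l₂)
  have hε2 := congrArg (homogeneousComponent 2) (show directional F (α 0) =
    p * κ₀ + q * η₀ + C (x 0) * ε by linear_combination hε)
  rw [homogeneousComponent_eq_self (isHomogeneous_directional F (hα 0)), map_add, map_add,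
    homogeneousComponent_C_mul,
    homogeneousComponent_add_mul (m := 1) (n := 1) (isHomogeneous_linearForm P),
    homogeneousComponent_add_mul (m := 1) (n := 1) (isHomogeneous_linearForm Q)] at hε2
  have hev := congrArg (eval F) hε2
  rw [eval_directional F (hα 0), hαG, map_add, map_add, map_mul, map_mul, map_mul, eval_C,
    eval_linearForm, eval_linearForm, hFP, hFQ] at hev
  have h3G : 3 * G = eval F (homogeneousComponent 2 ε) :=
    mul_left_cancel₀ hx0 (by push_cast at hev; linear_combination hev)
  rw [← Ideal.unit_mul_mem_iff_mem _ h3, h3G]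
  exact (Ideal.mem_span_pow_iff_exists_isHomogeneous _ _).2
    ⟨_, homogeneousComponent_isHomogeneous 2 ε, rfl⟩

theorem dotProduct_mem_of_forall_mem_sq (h : IsMinors P Q F)
    (hF : DetectsDvd (Ideal.span (Set.range F)))
    (hlin : ∀ (n : ℕ) (Φ : MvPolynomial (Fin 3) R), Φ.IsHomogeneous n → eval F Φ = 0 →
      Φ ∈ Ideal.span {linearForm P, linearForm Q})
    (hx : IsKoszulExact fun i => (C (x i) : MvPolynomial (Fin 3) R))
    (hG : ∀ G, (∀ i, x i * G ∈ Ideal.span (Set.range F) ^ 3) → G ∈ Ideal.span (Set.range F) ^ 2)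
    {w : Fin 3 → R} (hw : ∀ u ∈ symmImage P Q, u ⬝ᵥ w ∈ Ideal.span (Set.range x)) :
    F ⬝ᵥ w ∈ Ideal.span (Set.range x) := by
  obtain ⟨hFP, hFQ⟩ := h.dotProduct_eq_zero
  have hq := (h.linearForm_ne_zero hF).2
  have hkos := fun μ ν => h.exists_eq_mul hF (μ := μ) (ν := ν)
  have hDp := directional_linearForm_mul hFP
  have hDq := directional_linearForm_mul hFQ
  have hDC := directional_C_mul F
  have hx0 : x 0 ≠ 0 := fun h0 => hx.ne_zero (by simp [h0])
  have hpw := (linearForm_mul_mem_map_iff w).2 fun U hU =>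
    hw _ (mulVec_mem_symmImage (P := P) (Q := Q) hU)
  have hqw := (linearForm_mul_mem_map_iff w).2 fun U hU =>
    hw _ (symmImage_comm P Q ▸ mulVec_mem_symmImage (P := Q) (Q := P) hU)
  have hh : ∀ P : Fin 3 → R, (linearForm P * linearForm w).IsHomogeneous 2 := fun P =>
    (isHomogeneous_linearForm P).mul (isHomogeneous_linearForm w)
  obtain ⟨σ, hσ, hσw⟩ := exists_isHomogeneous_of_mem_map (hh Q) hqw
  obtain ⟨τ, hτ, hτw⟩ := exists_isHomogeneous_of_mem_map (hh P) hpw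
  set a := (C (x 0) : MvPolynomial (Fin 3) R) with ha
  set b := (C (x 1) : MvPolynomial (Fin 3) R) with hb
  set c := (C (x 2) : MvPolynomial (Fin 3) R) with hc
  set p := linearForm P with hp
  set q := linearForm Q with hq'
  have hδ : ∀ i, (p * σ i - q * τ i).IsHomogeneous 3 := fun i =>
    ((isHomogeneous_linearForm P).mul (hσ i)).sub ((isHomogeneous_linearForm Q).mul (hτ i))
  obtain ⟨θ, hθ, d₀, d₁, d₂⟩ := hx.triple_isHomogeneous (hδ 0) (hδ 1) (hδ 2)
    (by linear_combination -p * hσw + q * hτw)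
  have hevp : eval F p = 0 := (eval_linearForm F P).trans hFP
  have hevq : eval F q = 0 := (eval_linearForm F Q).trans hFQ
  have v₀ := congrArg (eval F) d₀
  have v₁ := congrArg (eval F) d₁
  have v₂ := congrArg (eval F) d₂
  simp only [map_sub, map_mul, hevp, hevq, eval_C] at v₀ v₁ v₂
  obtain ⟨ε, h1, h0⟩ := hx.pair (C (eval F (θ 1))) (C (eval F (θ 0))) (by
    simp only [← map_mul]
    exact congrArg C (by linear_combination -v₂))
  obtain ⟨G, hG0, hG1⟩ : ∃ G, eval F (θ 0) = x 0 * G ∧ eval F (θ 1) = x 1 * G :=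
    ⟨coeff 0 ε, by simpa using congrArg (coeff 0) h0, by simpa using congrArg (coeff 0) h1⟩
  have hG2 : eval F (θ 2) = x 2 * G :=
    mul_left_cancel₀ hx0 (by linear_combination v₁ + x 2 * hG0)
  have hGθ : ∀ i, eval F (θ i) = x i * G := fun i => by fin_cases i <;> assumption
  obtain ⟨ε, hε, hεG⟩ := (Ideal.mem_span_pow_iff_exists_isHomogeneous _ _).1 <|
    hG G fun i => (Ideal.mem_span_pow_iff_exists_isHomogeneous _ _).2 ⟨θ i, hθ i, hGθ i⟩
  have hrel : ∀ i, ∃ κ η, κ * p + η * q = directional F (θ i) - C (3 * x i) * ε := fun i => by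
    refine Ideal.mem_span_pair.1 (hlin 2 _
      ((isHomogeneous_directional F (hθ i)).sub (hε.C_mul _)) ?_)
    rw [map_sub, eval_directional F (hθ i), map_mul, eval_C, hεG, hGθ]
    push_cast
    ring
  choose κ η hκη using hrel
  simp only [map_mul] at hκη
  have D₀ := congrArg (directional F) d₀
  have D₁ := congrArg (directional F) d₁
  have D₂ := congrArg (directional F) d₂
  simp only [map_sub, hDp, hDq, hDC] at D₀ D₁ D₂
  obtain ⟨t₀, ht₀, -⟩ := hkos (directional F (σ 0) - b * κ 2 + c * κ 1)
    (-directional F (τ 0) - b * η 2 + c * η 1)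
    (by linear_combination D₀ - b * hκη 2 + c * hκη 1)
  obtain ⟨t₁, ht₁, -⟩ := hkos (directional F (σ 1) - c * κ 0 + a * κ 2)
    (-directional F (τ 1) - c * η 0 + a * η 2)
    (by linear_combination D₁ - c * hκη 0 + a * hκη 2)
  obtain ⟨t₂, ht₂, -⟩ := hkos (directional F (σ 2) - a * κ 1 + b * κ 0)
    (-directional F (τ 2) - a * η 1 + b * η 0)
    (by linear_combination D₂ - a * hκη 1 + b * hκη 0)
  have hDσ := congrArg (directional F) hσw
  rw [hDq, directional_linearForm] at hDσ
  simp only [map_add, ha, hb, hc, hDC] at hDσ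
  have hfin : C (F ⬝ᵥ w) = a * t₀ + b * t₁ + c * t₂ :=
    mul_left_cancel₀ hq (by linear_combination hDσ + a * ht₀ + b * ht₁ + c * ht₂)
  have hcoeff := congrArg (coeff 0) hfin
  simp only [coeff_add, ha, hb, hc, coeff_C_mul, coeff_zero_C] at hcoeff
  rw [hcoeff]
  exact add_mem (add_mem (Ideal.mul_mem_right _ _ (Ideal.subset_span ⟨0, rfl⟩))
    (Ideal.mul_mem_right _ _ (Ideal.subset_span ⟨1, rfl⟩)))
    (Ideal.mul_mem_right _ _ (Ideal.subset_span ⟨2, rfl⟩))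

end Chase

section Monomials

variable {σ K : Type*} [Field K]

theorem mem_span_X_pow_iff {s : Set σ} {N : ℕ} {F : MvPolynomial σ K} :
    F ∈ Ideal.span ((fun i => (X i : MvPolynomial σ K) ^ N) '' s) ↔
      ∀ e ∈ F.support, ∃ i ∈ s, N ≤ e i := by
  have h : (fun i => (X i : MvPolynomial σ K) ^ N) '' s =
      (fun e => monomial e (1 : K)) '' ((fun i => Finsupp.single i N) '' s) := by
    simp only [Set.image_image, X_pow_eq_monomial]
  rw [h, mem_ideal_span_monomial_image]
  simp [Finsupp.single_le_iff]

theorem X_pow_mul_mem_span_X_pow {s : Set σ} {N : ℕ} {F : MvPolynomial σ K} {j : σ} (hj : j ∉ s)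
    (h : X j ^ N * F ∈ Ideal.span ((fun i => (X i : MvPolynomial σ K) ^ N) '' s)) :
    F ∈ Ideal.span ((fun i => (X i : MvPolynomial σ K) ^ N) '' s) := by
  rw [mem_span_X_pow_iff] at h ⊢
  intro e he
  obtain ⟨i, hi, hN⟩ := h (Finsupp.single j N + e) (by
    rw [mem_support_iff, X_pow_eq_monomial, coeff_monomial_mul, one_mul]
    exact mem_support_iff.1 he)
  refine ⟨i, hi, ?_⟩
  rwa [Finsupp.add_apply, Finsupp.single_eq_of_ne (by rintro rfl; exact hj hi), zero_add] at hN

theorem C_X_pow_dvd {i j : σ} (hij : i ≠ j) (N : ℕ)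
    {α β : MvPolynomial (Fin 3) (MvPolynomial σ K)} (h : C (X i ^ N) * α = C (X j ^ N) * β) :
    ∃ ε, α = C (X j ^ N) * ε ∧ β = C (X i ^ N) * ε := by
  have hX : Prime (C (X j) : MvPolynomial (Fin 3) (MvPolynomial σ K)) :=
    (prime_C_iff _).2 X_prime
  obtain ⟨ε, hε⟩ := hX.pow_dvd_of_dvd_mul_left N (a := C (X i ^ N)) (b := α)
    (by
      rw [map_pow]
      intro hd
      have hd := hX.dvd_of_dvd_pow hd
      have := (C_dvd_iff_dvd_coeff _ _).1 hd 0
      rw [coeff_zero_C, X_dvd_X] at this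
      exact hij this.symm)
    ⟨β, by rw [h, map_pow]⟩
  rw [← map_pow] at hε
  refine ⟨ε, hε, mul_left_cancel₀ (a := C (X j ^ N)) ?_ ?_⟩
  · rw [Ne, C_eq_zero]
    exact pow_ne_zero _ (X_ne_zero j)
  · rw [← h, hε]
    ring

theorem isKoszulExact_X_pow (N : ℕ) : IsKoszulExact fun i : Fin 3 =>
    (C (X i ^ N) : MvPolynomial (Fin 3) (MvPolynomial (Fin 3) K)) where
  ne_zero := by
    rw [Ne, C_eq_zero]
    exact pow_ne_zero _ (X_ne_zero _)
  pair α β h := C_X_pow_dvd (by decide) N h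
  triple α β γ h := by
    have hα : α ∈ (Ideal.span ((fun i => (X i : MvPolynomial (Fin 3) K) ^ N) '' {1, 2})).map
        (C : _ →+* MvPolynomial (Fin 3) (MvPolynomial (Fin 3) K)) := by
      refine mem_map_C_iff.2 fun m => X_pow_mul_mem_span_X_pow (j := 0) (by simp) ?_
      have := congrArg (coeff m) h
      simp only [coeff_add, coeff_C_mul, coeff_zero] at this
      rw [Set.image_pair]
      exact Ideal.mem_span_pair.2 ⟨-coeff m β, -coeff m γ, by linear_combination -this⟩
    rw [Set.image_pair, Ideal.map_span, Set.image_pair, Ideal.mem_span_pair] at hα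
    obtain ⟨κ₂, κ₁, rfl⟩ := hα
    obtain ⟨ε, h1, h2⟩ := C_X_pow_dvd (i := 1) (j := 2) (by decide) N
      (α := β + C (X 0 ^ N) * κ₂) (β := -(γ + C (X 0 ^ N) * κ₁)) (by linear_combination h)
    exact ⟨ε, -κ₁, κ₂, by ring, by linear_combination h1, by linear_combination -h2⟩

end Monomials

section Duality

variable {K : Type*} [Field K]

/-- If the functional `φ` kills every monomial not dividing `X ^ T`, the dot products with a suitable
vector `w` have the values of `φ` as coefficients. -/
theorem exists_coeff_dotProduct_eq (φ : (Fin 3 → MvPolynomial (Fin 3) K) →ₗ[K] K)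
    (T : Fin 3 →₀ ℕ) (hφ : ∀ k d, ¬ d ≤ T → φ (Pi.single k (monomial d 1)) = 0) :
    ∃ w : Fin 3 → MvPolynomial (Fin 3) K, ∀ e ≤ T, ∀ u : Fin 3 → MvPolynomial (Fin 3) K,
      coeff e (u ⬝ᵥ w) = φ ((monomial (T - e) 1 : MvPolynomial (Fin 3) K) • u) := by
  refine ⟨fun k => ∑ f ∈ Finset.Icc 0 T, monomial f (φ (Pi.single k (monomial (T - f) 1))),
    fun e he u => ?_⟩
  set w : Fin 3 → MvPolynomial (Fin 3) K :=
    fun k => ∑ f ∈ Finset.Icc 0 T, monomial f (φ (Pi.single k (monomial (T - f) 1))) with hw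
  let L : (Fin 3 → MvPolynomial (Fin 3) K) →ₗ[K] K :=
    { toFun := fun u => coeff e (u ⬝ᵥ w)
      map_add' := fun u v => by simp [add_dotProduct]
      map_smul' := fun c u => by simp [smul_dotProduct] }
  let L' : (Fin 3 → MvPolynomial (Fin 3) K) →ₗ[K] K :=
    { toFun := fun u => φ ((monomial (T - e) 1 : MvPolynomial (Fin 3) K) • u)
      map_add' := fun u v => by simp [smul_add]
      map_smul' := fun c u => by simp [smul_comm _ c] }
  have key : L = L' := by
    refine LinearMap.pi_ext' fun k => MvPolynomial.linearMap_ext fun d => LinearMap.ext_ring ?_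
    simp only [LinearMap.comp_apply, LinearMap.single_apply]
    change coeff e ((Pi.single k (monomial d (1 : K)) : Fin 3 → MvPolynomial (Fin 3) K) ⬝ᵥ w) =
      φ ((monomial (T - e) 1 : MvPolynomial (Fin 3) K) • Pi.single k (monomial d 1))
    rw [single_dotProduct, coeff_monomial_mul', ← Pi.single_smul, smul_eq_mul, monomial_mul,
      mul_one]
    split_ifs with hd
    · rw [hw, coeff_sum, Finset.sum_eq_single (e - d)]
      · rw [coeff_monomial, if_pos rfl, one_mul,
          tsub_tsub_assoc he hd]
      · intro b _ hb
        rw [coeff_monomial, if_neg hb]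
      · intro h
        exact absurd (Finset.mem_Icc.2 ⟨zero_le, tsub_le_self.trans he⟩) h
    · exact (hφ k _ fun h =>
        hd (le_of_add_le_add_left (h.trans (tsub_add_cancel_of_le he).ge))).symm
  exact DFunLike.congr_fun key u

/-- The quotient of `K[X₀, X₁, X₂]` by `(X₀ ^ N, X₁ ^ N, X₂ ^ N)` is self-injective. -/
theorem exists_dotProduct_notMem {N : ℕ}
    {M : Submodule (MvPolynomial (Fin 3) K) (Fin 3 → MvPolynomial (Fin 3) K)}
    (hM : ∀ k i : Fin 3, Pi.single k (X i ^ N) ∈ M)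
    {v : Fin 3 → MvPolynomial (Fin 3) K} (hv : v ∉ M) :
    ∃ w, (∀ u ∈ M, u ⬝ᵥ w ∈ Ideal.span (Set.range fun i => (X i : MvPolynomial (Fin 3) K) ^ N)) ∧
      v ⬝ᵥ w ∉ Ideal.span (Set.range fun i => (X i : MvPolynomial (Fin 3) K) ^ N) := by
  obtain ⟨φ, hφv, hφM⟩ := Submodule.exists_le_ker_of_notMem (p := M.restrictScalars K) hv
  set T : Fin 3 →₀ ℕ := Finsupp.equivFunOnFinite.symm fun _ => N - 1 with hT
  have hMN : ∀ (k i : Fin 3) (d : Fin 3 →₀ ℕ), N ≤ d i →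
      Pi.single k (monomial d 1) ∈ M := fun k i d hd => by
    have := M.smul_mem (monomial (d - Finsupp.single i N) 1) (hM k i)
    rwa [← Pi.single_smul, smul_eq_mul, X_pow_eq_monomial, monomial_mul, mul_one,
      tsub_add_cancel_of_le (Finsupp.single_le_iff.2 hd)] at this
  obtain ⟨w, hw⟩ := exists_coeff_dotProduct_eq φ T fun k d hd => by
    obtain ⟨i, hi⟩ := not_forall.1 hd
    exact hφM (hMN k i d (by simp [hT] at hi; omega))
  rw [← Set.image_univ]
  refine ⟨w, fun u hu => mem_span_X_pow_iff.2 fun e he => ?_, fun h => ?_⟩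
  · by_contra! hlt
    refine mem_support_iff.1 he ((hw e (fun i => ?_) u).trans (hφM (M.smul_mem _ hu)))
    have := hlt i trivial
    simp only [hT, Finsupp.equivFunOnFinite_symm_apply_apply]
    omega
  · obtain ⟨i, -, hi⟩ := mem_span_X_pow_iff.1 h T <| by
      rw [mem_support_iff, hw T le_rfl]
      simpa using hφv
    have hN : N = 0 := by simp [hT] at hi; omega
    rw [pi_eq_sum_univ v] at hv
    refine hv (M.sum_mem fun k _ => M.smul_mem _ ?_)
    have := hM k 0
    rw [hN, pow_zero] at this
    convert this using 2 with l
    simp [Pi.single_apply, eq_comm]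

end Duality

section Points

variable {K : Type*} [Field K]

theorem eval_mul_of_isHomogeneous {F : MvPolynomial (Fin 3) K} {n : ℕ} (hF : F.IsHomogeneous n)
    (r : K) (p : Fin 3 → K) : eval (fun i => r * p i) F = r ^ n * eval p F :=
  aeval_mul_of_isHomogeneous r p hF

theorem mem_projVanishingIdeal {p : Fin 3 → K} {F : MvPolynomial (Fin 3) K} {n : ℕ}
    (hF : F.IsHomogeneous n) (h : eval p F = 0) : F ∈ projVanishingIdeal p :=
  Ideal.subset_span ⟨⟨n, hF⟩, h⟩

theorem isHomogeneous_line (a b : K) (i j : Fin 3) :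
    (C a * X i - C b * X j : MvPolynomial (Fin 3) K).IsHomogeneous 1 :=
  (isHomogeneous_C_mul_X a i).sub (isHomogeneous_C_mul_X b j)

theorem line_mem_projVanishingIdeal {p : Fin 3 → K} {j : Fin 3} (hj : p j ≠ 0) (i : Fin 3) :
    X i - C (p i / p j) * X j ∈ projVanishingIdeal p :=
  mem_projVanishingIdeal (n := 1)
    (by simpa using isHomogeneous_line 1 (p i / p j) i j)
    (by simp [div_mul_cancel₀ _ hj])

theorem projVanishingIdeal_le {p p' : Fin 3 → K} (hp : p ≠ 0)
    (h : ∀ i j, p' j * p i = p' i * p j) : projVanishingIdeal p ≤ projVanishingIdeal p' := by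
  obtain ⟨k, hk⟩ := Function.ne_iff.1 hp
  refine Ideal.span_le.2 fun F hF => ?_
  obtain ⟨⟨n, hFn⟩, hF0⟩ := hF
  refine mem_projVanishingIdeal hFn ?_
  have hp' : p' = fun i => p' k / p k * p i := funext fun i => by
    rw [div_mul_eq_mul_div, eq_div_iff hk, h]
  rw [hp', eval_mul_of_isHomogeneous hFn, hF0, mul_zero]

/-- A form not vanishing at `p` that multiplies the ideal of `p` into the ideals of the points of a
given finite set. -/
theorem exists_isHomogeneous_mul_mem (S : Finset (Fin 3 → K)) {p : Fin 3 → K} (hp : p ≠ 0) :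
    ∃ (s : MvPolynomial (Fin 3) K) (n : ℕ), s.IsHomogeneous n ∧ eval p s ≠ 0 ∧
      ∀ F ∈ projVanishingIdeal p, s * F ∈ ⨅ q ∈ S, projVanishingIdeal q := by
  classical
  induction S using Finset.induction_on with
  | empty => exact ⟨1, 0, isHomogeneous_one _ _, by simp, by simp⟩
  | insert q S _ ih =>
    obtain ⟨s, n, hs, hsp, hsF⟩ := ih
    simp only [Finset.iInf_insert, Submodule.mem_inf]
    by_cases h : ∀ i j, q j * p i = q i * p j
    · exact ⟨s, n, hs, hsp, fun F hF =>
        ⟨Ideal.mul_mem_left _ _ (projVanishingIdeal_le hp h hF), hsF F hF⟩⟩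
    · push Not at h
      obtain ⟨i, j, hij⟩ := h
      refine ⟨(C (q j) * X i - C (q i) * X j) * s, 1 + n, (isHomogeneous_line _ _ i j).mul hs, ?_,
        fun F hF => ⟨?_, ?_⟩⟩
      · simpa [sub_eq_zero, hsp] using hij
      · rw [mul_assoc]
        exact Ideal.mul_mem_right _ _ (mem_projVanishingIdeal (isHomogeneous_line _ _ i j)
          (by simp [mul_comm]))
      · rw [mul_assoc]
        exact Ideal.mul_mem_left _ _ (hsF F hF)

theorem X_mem_of_isPrime {p : Fin 3 → K} {𝔫 : Ideal (MvPolynomial (Fin 3) K)} (h𝔫 : 𝔫.IsPrime)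
    (hp : projVanishingIdeal p ≤ 𝔫) {s : MvPolynomial (Fin 3) K} {n : ℕ} (hs : s.IsHomogeneous n)
    (hsp : eval p s ≠ 0) (hs𝔫 : s ∈ 𝔫) (i : Fin 3) : X i ∈ 𝔫 := by
  have h := hp (mem_projVanishingIdeal (p := p)
    (((isHomogeneous_X_pow i n).C_mul (eval p s)).sub (hs.C_mul (p i ^ n)))
    (by simp [mul_comm]))
  have h' : C (eval p s) * X i ^ n ∈ 𝔫 := by
    simpa using Ideal.add_mem _ h (Ideal.mul_mem_left _ (C (p i ^ n)) hs𝔫)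
  rw [Ideal.unit_mul_mem_iff_mem _ ((isUnit_iff_ne_zero.2 hsp).map C)] at h'
  exact h𝔫.mem_of_pow_mem n h'

/-- The substitution `Xᵢ ↦ cᵢ Xⱼ + s (Xᵢ - cᵢ Xⱼ)`, with `c` the representative of the point `p`
whose `j`-th coordinate is `1`; the `s`-adic order of the image measures the order of vanishing. -/
noncomputable def expand (p : Fin 3 → K) (j : Fin 3) :
    MvPolynomial (Fin 3) K →ₐ[K] Polynomial (MvPolynomial (Fin 3) K) :=
  aeval fun i => Polynomial.C (C (p i / p j) * X j) +
    Polynomial.monomial 1 (X i - C (p i / p j) * X j)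

theorem expand_mem_reesAlgebra {p : Fin 3 → K} {j : Fin 3} (hj : p j ≠ 0)
    (F : MvPolynomial (Fin 3) K) : expand p j F ∈ reesAlgebra (projVanishingIdeal p) := by
  induction F using MvPolynomial.induction_on with
  | C a =>
    rw [algHom_C]
    exact (reesAlgebra (projVanishingIdeal p)).algebraMap_mem (C a)
  | add F G hF hG => rw [map_add]; exact add_mem hF hG
  | mul_X F i hF =>
    rw [map_mul]
    refine mul_mem hF ?_
    rw [expand, aeval_X]
    refine add_mem ((reesAlgebra (projVanishingIdeal p)).algebraMap_mem _) ?_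
    rw [reesAlgebra.monomial_mem, pow_one]
    exact line_mem_projVanishingIdeal hj i

theorem eval_one_expand (p : Fin 3 → K) (j : Fin 3) (F : MvPolynomial (Fin 3) K) :
    (expand p j F).eval 1 = F := by
  have h : ((Polynomial.aeval (1 : MvPolynomial (Fin 3) K)).restrictScalars K).comp (expand p j) =
      AlgHom.id K _ := MvPolynomial.algHom_ext fun i => by simp [expand]
  exact DFunLike.congr_fun h F

theorem X_dvd_expand (j : Fin 3) {p : Fin 3 → K} {F : MvPolynomial (Fin 3) K}
    (hF : F ∈ projVanishingIdeal p) : Polynomial.X ∣ expand p j F := by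
  rw [← Ideal.mem_span_singleton]
  suffices projVanishingIdeal p ≤ (Ideal.span {Polynomial.X}).comap (expand p j) from this hF
  refine Ideal.span_le.2 fun F hF => ?_
  obtain ⟨⟨n, hFn⟩, hF0⟩ := hF
  rw [SetLike.mem_coe, Ideal.mem_comap, Ideal.mem_span_singleton, Polynomial.X_dvd_iff]
  have h : (((Polynomial.aeval (0 : MvPolynomial (Fin 3) K)).restrictScalars K).comp
      (expand p j)) = aeval fun i => (X j * C (p i / p j) : MvPolynomial (Fin 3) K) :=
    MvPolynomial.algHom_ext fun i => by simp [expand, mul_comm]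
  have h' := DFunLike.congr_fun h F
  rw [aeval_mul_of_isHomogeneous _ _ hFn] at h'
  have h0 := aeval_algebraMap_apply (MvPolynomial (Fin 3) K) (fun i => p i / p j) F
  have h1 := eval_mul_of_isHomogeneous hFn (p j)⁻¹ p
  rw [hF0, mul_zero] at h1
  simp only [← div_eq_inv_mul] at h1
  rw [show aeval (fun i => p i / p j) F = eval (fun i => p i / p j) F from rfl, h1, map_zero,
    algebraMap_eq] at h0
  rw [show aeval (fun i => (C (p i / p j) : MvPolynomial (Fin 3) K)) F = 0 from h0, mul_zero] at h'
  rw [Polynomial.coeff_zero_eq_eval_zero]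
  exact h'

theorem mem_projVanishingIdeal_pow_iff {p : Fin 3 → K} {j : Fin 3} (hj : p j ≠ 0) {n : ℕ}
    {F : MvPolynomial (Fin 3) K} :
    F ∈ projVanishingIdeal p ^ n ↔ Polynomial.X ^ n ∣ expand p j F := by
  constructor
  · intro hF
    have : projVanishingIdeal p ≤ (Ideal.span {Polynomial.X}).comap (expand p j) := fun G hG =>
      Ideal.mem_span_singleton.2 (X_dvd_expand j hG)
    have h := Ideal.le_comap_pow _ n (Ideal.pow_right_mono this n hF)
    rwa [Ideal.mem_comap, Ideal.span_singleton_pow, Ideal.mem_span_singleton] at h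
  · intro h
    rw [← eval_one_expand p j F, Polynomial.eval_eq_sum_range]
    refine Ideal.sum_mem _ fun k _ => ?_
    rw [one_pow, mul_one]
    rcases lt_or_ge k n with hk | hk
    · rw [Polynomial.X_pow_dvd_iff.1 h k hk]
      exact zero_mem _
    · exact Ideal.pow_le_pow_right hk (mem_reesAlgebra_iff _ _ |>.1 (expand_mem_reesAlgebra hj F) k)

/-- Powers of the ideal of a point are saturated. -/
theorem mem_projVanishingIdeal_pow_of_X_pow_mul {p : Fin 3 → K} {j : Fin 3} (hj : p j ≠ 0)
    {n N : ℕ} {F : MvPolynomial (Fin 3) K} (h : X j ^ N * F ∈ projVanishingIdeal p ^ n) :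
    F ∈ projVanishingIdeal p ^ n := by
  rw [mem_projVanishingIdeal_pow_iff hj, Polynomial.X_pow_dvd_iff] at h ⊢
  intro k hk
  have hX : expand p j (X j) = Polynomial.C (X j) := by simp [expand, div_self hj]
  have := h k hk
  rw [map_mul, map_pow, hX, ← Polynomial.C_pow, Polynomial.coeff_C_mul] at this
  exact (mul_eq_zero.1 this).resolve_left (pow_ne_zero _ (X_ne_zero j))

/-- Two lines through a point which meet only there form a regular sequence. -/
theorem line_dvd_of_dvd_mul {i j k : Fin 3} (hij : i ≠ j) (hik : i ≠ k) (hkj : k ≠ j) (a b : K)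
    {F : MvPolynomial (Fin 3) K} (h : X i - C a * X j ∣ (X k - C b * X j) * F) :
    X i - C a * X j ∣ F := by
  set ρ : MvPolynomial (Fin 3) K →ₐ[K] MvPolynomial (Fin 3) K :=
    aeval (Function.update X i (C a * X j)) with hρ
  have hρF : F - ρ F ∈ Ideal.span {X i - C a * X j} := by
    have h : (Ideal.Quotient.mkₐ K (Ideal.span {X i - C a * X j})).comp ρ =
        Ideal.Quotient.mkₐ K _ := by
      refine MvPolynomial.algHom_ext fun l => ?_
      rw [AlgHom.comp_apply, hρ, aeval_X]
      rcases eq_or_ne l i with rfl | hl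
      · rw [Function.update_self]
        exact (Ideal.Quotient.eq.2 (Ideal.mem_span_singleton_self _)).symm
      · rw [Function.update_of_ne hl]
    exact Ideal.Quotient.eq.1 (DFunLike.congr_fun h F).symm
  obtain ⟨G, hG⟩ := h
  have h0 := congrArg ρ hG
  have hk : (X k - C b * X j : MvPolynomial (Fin 3) K) ≠ 0 := fun h => by
    have := congrArg (eval (Pi.single k 1 : Fin 3 → K)) h
    simp [hkj.symm] at this
  have hρ0 : ρ F = 0 := by
    simpa [hρ, Function.update_of_ne hik.symm, Function.update_of_ne hij.symm, hk] using h0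
  rwa [hρ0, sub_zero, Ideal.mem_span_singleton] at hρF

theorem detectsDvd_projVanishingIdeal {p : Fin 3 → K} (hp : p ≠ 0) :
    DetectsDvd (projVanishingIdeal p) := by
  obtain ⟨j, hj⟩ := Function.ne_iff.1 hp
  obtain ⟨i, k, hij, hik, hkj⟩ : ∃ i k : Fin 3, i ≠ j ∧ i ≠ k ∧ k ≠ j := by
    clear hj
    revert j
    decide
  intro ℓ Φ h
  obtain ⟨Y, hY⟩ := h _ (line_mem_projVanishingIdeal hj i)
  obtain ⟨Y', hY'⟩ := h _ (line_mem_projVanishingIdeal hj k)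
  set r : MvPolynomial (Fin 3) K := X i - C (p i / p j) * X j
  set t : MvPolynomial (Fin 3) K := X k - C (p k / p j) * X j
  have hr : (C r : MvPolynomial (Fin 3) (MvPolynomial (Fin 3) K)) ≠ 0 := fun h => by
    have := congrArg (eval (Pi.single i 1 : Fin 3 → K)) (C_eq_zero.1 h)
    simp [r, hij.symm] at this
  rcases eq_or_ne ℓ 0 with rfl | hℓ
  · rw [zero_mul, mul_eq_zero] at hY
    rw [hY.resolve_left hr]
  · have hYY' : C t * Y = C r * Y' :=
      mul_left_cancel₀ hℓ (by linear_combination C r * hY' - C t * hY)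
    have hdvd : C r ∣ Y := (C_dvd_iff_dvd_coeff _ _).2 fun m =>
      line_dvd_of_dvd_mul hij hik hkj _ _
        ⟨coeff m Y', by rw [← coeff_C_mul, ← coeff_C_mul, hYY']⟩
    obtain ⟨Z, rfl⟩ := hdvd
    exact ⟨Z, mul_left_cancel₀ hr (by linear_combination hY)⟩

theorem prod_projVanishingIdeal_le (S : Finset (Fin 3 → K)) :
    ∏ p ∈ S, projVanishingIdeal p ≤ ⨅ p ∈ S, projVanishingIdeal p := by
  rw [← Finset.inf_eq_iInf]
  exact Ideal.prod_le_inf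

theorem detectsDvd_iInf {S : Finset (Fin 3 → K)} (hS : ∀ p ∈ S, p ≠ 0) :
    DetectsDvd (⨅ p ∈ S, projVanishingIdeal p) :=
  (DetectsDvd.prod S fun p hp => detectsDvd_projVanishingIdeal (hS p hp)).mono
    (prod_projVanishingIdeal_le S)

/-- A criterion for an ideal containing the ideal of a finite set of points to contain a power of
the irrelevant ideal, up to radical. -/
theorem X_mem_radical {S : Finset (Fin 3 → K)} (hS : ∀ p ∈ S, p ≠ 0)
    {J : Ideal (MvPolynomial (Fin 3) K)} (hJ : ⨅ p ∈ S, projVanishingIdeal p ≤ J.radical)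
    (h : ∀ 𝔫 : Ideal (MvPolynomial (Fin 3) K), 𝔫.IsPrime → J ≤ 𝔫 → ∀ p ∈ S,
      projVanishingIdeal p ≤ 𝔫 → ∀ s : MvPolynomial (Fin 3) K,
      (∀ F ∈ projVanishingIdeal p, s * F ∈ ⨅ q ∈ S, projVanishingIdeal q) → s ∈ 𝔫) (i : Fin 3) :
    X i ∈ J.radical := by
  rw [Ideal.radical_eq_sInf, Submodule.mem_sInf]
  rintro 𝔫 ⟨hJ𝔫, h𝔫⟩
  obtain ⟨p, hp, hp𝔫⟩ := h𝔫.prod_le.1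
    ((prod_projVanishingIdeal_le S).trans (hJ.trans (h𝔫.radical_le_iff.2 hJ𝔫)))
  obtain ⟨s, n, hs, hsp, hsF⟩ := exists_isHomogeneous_mul_mem S (hS p hp)
  exact X_mem_of_isPrime h𝔫 hp𝔫 hs hsp (h 𝔫 h𝔫 hJ𝔫 p hp hp𝔫 s hsF) i

theorem derivation_mem_of_mem_sq {R : Type*} [CommRing R] [Algebra K R] (D : Derivation K R R)
    {L : Ideal R} {a : R} (ha : a ∈ L ^ 2) : D a ∈ L := by
  rw [pow_two] at ha
  induction ha using Submodule.mul_induction_on' with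
  | mem_mul_mem m hm n hn =>
    rw [D.leibniz]
    exact add_mem (Ideal.mul_mem_right _ _ hm) (Ideal.mul_mem_right _ _ hn)
  | add x _ y _ hx hy => rw [map_add]; exact add_mem hx hy

/-- If the square of an ideal contains the ideal of a finite set of points, the ideal has no zeros
in the projective plane. -/
theorem X_mem_radical_of_le_sq {S : Finset (Fin 3 → K)} (hS : ∀ p ∈ S, p ≠ 0)
    {L : Ideal (MvPolynomial (Fin 3) K)} (hL : ⨅ p ∈ S, projVanishingIdeal p ≤ L ^ 2)
    (i : Fin 3) : X i ∈ L.radical := by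
  refine X_mem_radical hS ((hL.trans (Ideal.pow_le_self two_ne_zero)).trans Ideal.le_radical)
    (fun 𝔫 _ hL𝔫 p hp hp𝔫 s hs => ?_) i
  obtain ⟨j, hj⟩ := Function.ne_iff.1 (hS p hp)
  obtain ⟨k, hkj⟩ := exists_ne j
  have hline := line_mem_projVanishingIdeal hj k
  have := hL𝔫 (derivation_mem_of_mem_sq (pderiv k) (hL (hs _ hline)))
  rw [Derivation.leibniz] at this
  simpa [Derivation.leibniz, hkj, hkj.symm, Pi.single_apply] using
    (Ideal.add_mem_iff_left _ (Ideal.mul_mem_right _ _ (hp𝔫 hline))).1 this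

theorem exists_forall_pow_mem {R ι : Type*} [CommRing R] [Finite ι] {J : Ideal R} {x : ι → R}
    (h : ∀ i, x i ∈ J.radical) : ∃ N, ∀ i, x i ^ N ∈ J := by
  cases nonempty_fintype ι
  choose n hn using h
  exact ⟨∑ i, n i, fun i => J.pow_mem_of_pow_mem (hn i)
    (Finset.single_le_sum (f := n) (fun _ _ => Nat.zero_le _) (Finset.mem_univ i))⟩

/-- Membership in a symbolic power is membership in the ordinary power up to a power of the
irrelevant ideal. -/
theorem mem_iInf_pow_iff {S : Finset (Fin 3 → K)} (hS : ∀ p ∈ S, p ≠ 0) {n : ℕ}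
    {F : MvPolynomial (Fin 3) K} :
    F ∈ ⨅ p ∈ S, projVanishingIdeal p ^ n ↔
      ∃ N : ℕ, ∀ i : Fin 3, X i ^ N * F ∈ (⨅ p ∈ S, projVanishingIdeal p) ^ n := by
  constructor
  · intro hF
    set I : Ideal (MvPolynomial (Fin 3) K) := ⨅ p ∈ S, projVanishingIdeal p
    refine exists_forall_pow_mem (J := Submodule.comap (LinearMap.toSpanSingleton _ _ F) (I ^ n))
      (X_mem_radical hS (fun a ha => ⟨n, ?_⟩) fun 𝔫 h𝔫 hJ p hp _ s hs => ?_)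
    · exact Ideal.mul_mem_right _ _ (Ideal.pow_mem_pow ha n)
    · refine h𝔫.mem_of_pow_mem n (hJ ?_)
      have hle : Ideal.span {s} * projVanishingIdeal p ≤ I :=
        Ideal.span_singleton_mul_le_iff.2 hs
      have := Ideal.pow_right_mono hle n
      rw [mul_pow, Ideal.span_singleton_pow] at this
      simp only [Submodule.mem_iInf] at hF
      exact this (Ideal.mul_mem_mul (Ideal.mem_span_singleton_self _) (hF p hp))
  · rintro ⟨N, hN⟩
    simp only [Submodule.mem_iInf]
    intro p hp
    obtain ⟨j, hj⟩ := Function.ne_iff.1 (hS p hp)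
    exact mem_projVanishingIdeal_pow_of_X_pow_mul hj
      (Ideal.pow_right_mono (iInf₂_le p hp) n (hN j))

end Points

section Matrices

variable {R : Type*} [CommRing R] {P Q F x : Fin 3 → R}

theorem mem_symmImage_iff :
    F ∈ symmImage P Q ↔ ∃ u : Fin 12 → R,
      F 0 = P 0 * u 0 + P 1 * u 1 + P 2 * u 2 - Q 0 * u 6 - Q 1 * u 7 - Q 2 * u 8 ∧
      F 1 = P 0 * u 1 + P 1 * u 3 + P 2 * u 4 - Q 0 * u 7 - Q 1 * u 9 - Q 2 * u 10 ∧
      F 2 = P 0 * u 2 + P 1 * u 4 + P 2 * u 5 - Q 0 * u 8 - Q 1 * u 10 - Q 2 * u 11 := by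
  constructor
  · rintro ⟨U, V, hU, hV, rfl⟩
    refine ⟨![U 0 0, U 0 1, U 0 2, U 1 1, U 1 2, U 2 2,
      -V 0 0, -V 0 1, -V 0 2, -V 1 1, -V 1 2, -V 2 2], ?_, ?_, ?_⟩ <;>
    · simp [Matrix.mulVec, dotProduct, Fin.sum_univ_three, hU.apply 0 1, hU.apply 0 2, hU.apply 1 2,
        hV.apply 0 1, hV.apply 0 2, hV.apply 1 2]
      ring
  · rintro ⟨u, h0, h1, h2⟩
    refine ⟨!![u 0, u 1, u 2; u 1, u 3, u 4; u 2, u 4, u 5],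
      -!![u 6, u 7, u 8; u 7, u 9, u 10; u 8, u 10, u 11], ?_, ?_, ?_⟩
    · ext i j
      fin_cases i <;> fin_cases j <;> rfl
    · ext i j
      fin_cases i <;> fin_cases j <;> rfl
    · ext1 i
      fin_cases i <;>
      · simp [dotProduct, Fin.sum_univ_three, h0, h1, h2]
        ring

theorem IsMinors.span_le_sq (h : IsMinors P Q F) :
    Ideal.span (Set.range F) ≤ Ideal.span (Set.range P ∪ Set.range Q) ^ 2 := by
  have hPQ : ∀ i j, P i * Q j ∈ Ideal.span (Set.range P ∪ Set.range Q) ^ 2 := fun i j => by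
    rw [pow_two]
    exact Ideal.mul_mem_mul (Ideal.subset_span (Or.inl ⟨i, rfl⟩))
      (Ideal.subset_span (Or.inr ⟨j, rfl⟩))
  obtain ⟨h0, h1, h2⟩ := h
  rw [Ideal.span_le]
  rintro _ ⟨i, rfl⟩
  fin_cases i
  · exact h0 ▸ sub_mem (hPQ _ _) (hPQ _ _)
  · exact h1 ▸ sub_mem (hPQ _ _) (hPQ _ _)
  · exact h2 ▸ sub_mem (hPQ _ _) (hPQ _ _)

theorem exists_single_mem_symmImage
    (hx : ∀ i, x i ∈ (Ideal.span (Set.range P ∪ Set.range Q)).radical) :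
    ∃ N : ℕ, ∀ k i : Fin 3, Pi.single k (x i ^ N) ∈ symmImage P Q := by
  let J : Fin 3 → Ideal R := fun k => (symmImage P Q).comap (LinearMap.single R (fun _ => R) k)
  have hLJ : Ideal.span (Set.range P ∪ Set.range Q) ≤ (⨅ k, J k).radical := by
    rw [Ideal.span_le]
    rintro _ (⟨i, rfl⟩ | ⟨i, rfl⟩) <;> refine ⟨2, ?_⟩ <;> rw [Submodule.mem_iInf] <;> intro k
    · exact sq_single_mem_symmImage i k
    · change _ ∈ symmImage P Q
      rw [symmImage_comm]
      exact sq_single_mem_symmImage i k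
  obtain ⟨N, hN⟩ := exists_forall_pow_mem fun i => Ideal.radical_le_radical_iff.2 hLJ (hx i)
  exact ⟨N, fun k i => (Submodule.mem_iInf _).1 (hN i) k⟩

end Matrices

section Criterion

variable {K : Type*} [Field K] {P Q F : Fin 3 → MvPolynomial (Fin 3) K} {S : Finset (Fin 3 → K)}

/-- The containment criterion in terms of the symmetric matrices. -/
theorem iInf_cube_le_sq_iff (hchar : ringChar K ≠ 3) (h : IsMinors P Q F) (hS : ∀ p ∈ S, p ≠ 0)
    (hF : Ideal.span (Set.range F) = ⨅ p ∈ S, projVanishingIdeal p) :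
    ⨅ p ∈ S, projVanishingIdeal p ^ 3 ≤ Ideal.span (Set.range F) ^ 2 ↔ F ∈ symmImage P Q := by
  have hdvd : DetectsDvd (Ideal.span (Set.range F)) := hF ▸ detectsDvd_iInf hS
  have hXL : ∀ i, X i ∈ (Ideal.span (Set.range P ∪ Set.range Q)).radical :=
    X_mem_radical_of_le_sq hS (hF ▸ h.span_le_sq)
  have hlin : ∀ (n : ℕ) (Φ : MvPolynomial (Fin 3) (MvPolynomial (Fin 3) K)), Φ.IsHomogeneous n →
      eval F Φ = 0 → Φ ∈ Ideal.span {linearForm P, linearForm Q} := fun n Φ =>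
    h.mem_of_eval_eq_zero hdvd isKoszulExact_X_pow hXL
  constructor
  · intro hle
    by_contra hFM
    obtain ⟨N, hN⟩ := exists_single_mem_symmImage hXL
    obtain ⟨w, hw, hwF⟩ := exists_dotProduct_notMem hN hFM
    refine hwF (dotProduct_mem_of_forall_mem_sq h hdvd hlin (isKoszulExact_X_pow N)
      (fun G hG => hle ((mem_iInf_pow_iff hS).2 ⟨N, fun i => ?_⟩)) hw)
    rw [← hF]
    exact hG i
  · intro hFM G hG
    obtain ⟨N, hN⟩ := (mem_iInf_pow_iff hS).1 hG
    rw [← hF] at hN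
    have h3 : (3 : K) ≠ 0 := fun h3 => by
      have := ringChar.dvd (R := K) (x := 3) (by exact_mod_cast h3)
      rcases (Nat.dvd_prime Nat.prime_three).1 this with h1 | h1
      · exact CharP.ringChar_ne_one h1
      · exact hchar h1
    refine mem_sq_of_mem_symmImage h hdvd hlin (isKoszulExact_X_pow N) ?_ hFM hN
    rw [← map_ofNat (C : K →+* MvPolynomial (Fin 3) K) 3]
    exact (isUnit_iff_ne_zero.2 h3).map C

end Criterion

end SeceleanuCriterion

/-- Seceleanu's criterion: for a 3-generated radical ideal `I = (f, g, h)` of a finite set of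
points in the projective plane over a field `K` of characteristic `≠ 3`, with `f, g, h`
homogeneous of the same degree `d`, minimal generators, and with Hilbert–Burch (syzygy) matrix
having rows `(P₁, P₂, P₃)` and `(Q₁, Q₂, Q₃)`, the containment `I⁽³⁾ ⊆ I²` holds if and only
if `(f, g, h)ᵀ` lies in the image of `Yᵀ` for the matrix `Y` representing the last map in the
minimal free resolution of `I³`. -/
theorem seceleanu_criterion (K : Type*) [Field K] (hchar : ringChar K ≠ 3) (d : ℕ)
    (P₁ P₂ P₃ Q₁ Q₂ Q₃ f g h : MvPolynomial (Fin 3) K)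
    (hf : f = P₂ * Q₃ - P₃ * Q₂) (hg : g = P₃ * Q₁ - P₁ * Q₃) (hh : h = P₁ * Q₂ - P₂ * Q₁)
    (I : Ideal (MvPolynomial (Fin 3) K)) (hI : I = Ideal.span {f, g, h})
    (hfd : f.IsHomogeneous d) (hgd : g.IsHomogeneous d) (hhd : h.IsHomogeneous d)
    (hmin : f ∉ Ideal.span {g, h} ∧ g ∉ Ideal.span {f, h} ∧ h ∉ Ideal.span {f, g})
    (hsyz : ∀ a b c : MvPolynomial (Fin 3) K, a * f + b * g + c * h = 0 →
      ∃ u v : MvPolynomial (Fin 3) K,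
        a = u * P₁ + v * Q₁ ∧ b = u * P₂ + v * Q₂ ∧ c = u * P₃ + v * Q₃)
    (S : Finset (Fin 3 → K)) (hSne : S.Nonempty) (hS0 : ∀ p ∈ S, p ≠ 0)
    (hrad : I = ⨅ p ∈ S, projVanishingIdeal p) :
    (⨅ p ∈ S, (projVanishingIdeal p) ^ 3) ≤ I ^ 2 ↔
      ∃ u : Fin 12 → MvPolynomial (Fin 3) K,
        f = P₁ * u 0 + P₂ * u 1 + P₃ * u 2 - Q₁ * u 6 - Q₂ * u 7 - Q₃ * u 8 ∧
        g = P₁ * u 1 + P₂ * u 3 + P₃ * u 4 - Q₁ * u 7 - Q₂ * u 9 - Q₃ * u 10 ∧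
        h = P₁ * u 2 + P₂ * u 4 + P₃ * u 5 - Q₁ * u 8 - Q₂ * u 10 - Q₃ * u 11 := by
  have hI' : I = Ideal.span (Set.range ![f, g, h]) := by
    rw [hI, Matrix.range_cons, Matrix.range_cons, Matrix.range_cons_empty]
    rfl
  have hminors : SeceleanuCriterion.IsMinors ![P₁, P₂, P₃] ![Q₁, Q₂, Q₃] ![f, g, h] := ⟨hf, hg, hh⟩
  rw [hI', SeceleanuCriterion.iInf_cube_le_sq_iff hchar hminors hS0 (hI' ▸ hrad),
    SeceleanuCriterion.mem_symmImage_iff]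
  rfl
end
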